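/- arXiv:1710.07722 — 3 statements merged into one kernel-verified Lean document; each statement's English description precedes it below -/
import Mathlib

section
/- For each i ∈ [k+1], let {A_T^(i) : T a nonempty subset of [k+1]} be a family of closed subsets of the standard k-simplex Δ_k such that Δ^S ⊆ ⋃_{T ⊆ S, T ≠ ∅} A_T^(i) for every nonempty S ⊆ [k+1] (i.e., each of the k+1 families is a KKMS cover). Then there exists a balanced collection T_1, …, T_{k+1} of nonempty subsets of [k+1] such that ⋂_{i=1}^{k+1} A_{T_i}^(i) ≠ ∅. -/
/-- The face `Δ^S` of the standard simplex spanned by the vertices in `S`. -/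
def simplexFace (k : ℕ) (S : Finset (Fin (k + 1))) : Set (Fin (k + 1) → ℝ) :=
  {x ∈ stdSimplex ℝ (Fin (k + 1)) | ∀ i ∉ S, x i = 0}

/-- The barycenter of the face `Δ^S` of the standard simplex. -/
noncomputable def faceBarycenter (k : ℕ) (S : Finset (Fin (k + 1))) : Fin (k + 1) → ℝ :=
  fun i => if i ∈ S then (S.card : ℝ)⁻¹ else 0

section Scarf

variable {X I : Type*}

/-- A finite set `Z` is dominant for a family of preferences `r i` if no element is strictly
preferred, for every `i`, to the `i`-worst element of `Z`. -/
def Dominant (r : I → X → ℕ) (Z : Finset X) : Prop :=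
  ∀ y, ∃ i, ∀ x ∈ Z, r i y ≤ r i x

theorem Dominant.mono {r : I → X → ℕ} {Y Z : Finset X} (h : Dominant r Z) (hYZ : Y ⊆ Z) :
    Dominant r Y := fun y => (h y).imp fun _ hi x hx => hi x (hYZ hx)

variable [Fintype I] [DecidableEq X] [DecidableEq I]

theorem even_card_erase_image_eq {Z : Finset X} (hZ : Z.card = Fintype.card I) (c : X → I)
    (i₀ : I) (hc : Z.image c ≠ Finset.univ) :
    Even (Z.filter fun x => (Z.erase x).image c = Finset.univ.erase i₀).card := by
  classical
  rcases (Z.filter fun x => (Z.erase x).image c = Finset.univ.erase i₀).eq_empty_or_nonempty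
    with h | ⟨x, hx⟩
  · simp [h]
  obtain ⟨hxZ, hx⟩ := Finset.mem_filter.1 hx
  have hcx : c x ≠ i₀ := by
    intro h
    apply hc
    rw [← Finset.insert_erase hxZ, Finset.image_insert, hx, h]
    exact Finset.insert_erase (Finset.mem_univ _)
  have hmem : c x ∈ (Z.erase x).image c := by rw [hx]; simp [hcx]
  obtain ⟨x', hx', hcc⟩ := Finset.mem_image.1 hmem
  obtain ⟨hne, hx'Z⟩ := Finset.mem_erase.1 hx'
  have key : (Z.filter fun y => (Z.erase y).image c = Finset.univ.erase i₀) = {x, x'} := by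
    ext y
    simp only [Finset.mem_filter, Finset.mem_insert, Finset.mem_singleton]
    constructor
    · rintro ⟨hyZ, hy⟩
      by_contra! hcon
      have hinj : Set.InjOn c (Z.erase y) := by
        apply Finset.card_image_iff.1
        rw [hy, Finset.card_erase_of_mem (Finset.mem_univ _), Finset.card_erase_of_mem hyZ, hZ,
          Finset.card_univ]
      exact hne (hinj (by simp [hx'Z, hcon.2.symm]) (by simp [hxZ, hcon.1.symm]) hcc)
    · rintro (rfl | rfl)
      · exact ⟨hxZ, hx⟩
      · refine ⟨hx'Z, ?_⟩
        rw [← hx]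
        ext i
        simp only [Finset.mem_image, Finset.mem_erase]
        constructor
        · rintro ⟨w, ⟨hw, hwZ⟩, rfl⟩
          by_cases hwx : w = x
          · exact ⟨y, ⟨hne, hx'Z⟩, by rw [hwx, hcc]⟩
          · exact ⟨w, ⟨hwx, hwZ⟩, rfl⟩
        · rintro ⟨w, ⟨hw, hwZ⟩, rfl⟩
          by_cases hwx : w = y
          · exact ⟨x, ⟨hne.symm, hxZ⟩, by rw [hwx, hcc]⟩
          · exact ⟨w, ⟨hwx, hwZ⟩, rfl⟩
  rw [key, Finset.card_pair hne.symm]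
  exact even_two

open Classical in
theorem Dominant.even_card_insert [Fintype X] {r : I → X → ℕ}
    (hr : ∀ i, Function.Injective (r i)) {Z : Finset X} (hd : Dominant r Z)
    (hZ : Z.card + 1 = Fintype.card I) (hne : Z.Nonempty)
    (hex : ∀ i, ∃ s, ∀ l ≠ i, ∃ x ∈ Z, r l x < r l s) :
    Even (Finset.univ.filter fun y => y ∉ Z ∧ Dominant r (insert y Z)).card := by
  choose m hmZ hmin using fun l => Z.exists_min_image (r l) hne
  have hsurj : ∀ x ∈ Z, ∃ i, m i = x := fun x hx => by
    obtain ⟨i, hi⟩ := hd x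
    exact ⟨i, hr i (le_antisymm (hmin i x hx) (hi _ (hmZ i)))⟩
  obtain ⟨i, -, j, -, hij, hmij⟩ := Finset.exists_ne_map_eq_of_card_lt_of_maps_to
    (s := Finset.univ) (t := Z) (f := m) (by rw [Finset.card_univ]; omega) (fun l _ => hmZ l)
  have hinj : ∀ l, (∀ x ∈ Z, ∃ l' ≠ l, m l' = x) → l = i ∨ l = j := by
    intro l hl
    have him : (Finset.univ.erase l).image m = Z := by
      ext x
      simp only [Finset.mem_image, Finset.mem_erase, Finset.mem_univ, and_true]
      exact ⟨by rintro ⟨l', -, rfl⟩; exact hmZ l', hl x⟩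
    have : Set.InjOn m (Finset.univ.erase l : Finset I) := by
      apply Finset.card_image_iff.1
      rw [him, Finset.card_erase_of_mem (Finset.mem_univ _), Finset.card_univ]
      omega
    by_contra! hcon
    exact hij (this (by simp [hcon.1.symm]) (by simp [hcon.2.symm]) hmij)
  have hmax : ∀ l, ∃ g, (∀ l' ≠ l, r l' (m l') < r l' g) ∧
      ∀ y, (∀ l' ≠ l, r l' (m l') < r l' y) → r l y ≤ r l g := by
    intro l
    obtain ⟨s, hs⟩ := hex l
    obtain ⟨g, hg, hg'⟩ := (Finset.univ.filter fun y =>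
      ∀ l' ≠ l, r l' (m l') < r l' y).exists_max_image (r l) ⟨s, by
        simp only [Finset.mem_filter, Finset.mem_univ, true_and]
        intro l' hl'
        obtain ⟨x, hx, hlt⟩ := hs l' hl'
        exact (hmin l' x hx).trans_lt hlt⟩
    exact ⟨g, (Finset.mem_filter.1 hg).2, fun y hy => hg' y (by simpa using hy)⟩
  choose g hg hgmax using hmax
  have hnall : ∀ z, ¬ ∀ l, r l (m l) < r l z := fun z hz => by
    obtain ⟨l, hl⟩ := hd z
    exact (hz l).not_ge (hl _ (hmZ l))
  have hgdom : ∀ l, Dominant r (insert (g l) Z) := by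
    intro l z
    by_contra! hcon
    have hzY : ∀ l' ≠ l, r l' (m l') < r l' z := by
      intro l' hl'
      obtain ⟨x, hx, hxz⟩ := hcon l'
      rcases Finset.mem_insert.1 hx with rfl | hx
      · exact (hg l l' hl').trans hxz
      · exact (hmin l' x hx).trans_lt hxz
    obtain ⟨x, hx, hxz⟩ := hcon l
    rcases Finset.mem_insert.1 hx with rfl | hx
    · exact hxz.not_ge (hgmax l z hzY)
    · refine hnall z fun l' => ?_
      by_cases h : l' = l
      · rw [h]; exact (hmin _ x hx).trans_lt hxz
      · exact hzY l' h
  have hgZ : ∀ l l', l ≠ l' → m l = m l' → g l ∉ Z := by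
    intro l l' hne hmm hmem
    obtain ⟨q, hq⟩ := hsurj _ hmem
    by_cases h : q = l
    · subst h
      have := hg q l' hne.symm
      rw [← hmm, hq] at this
      exact this.false
    · have := hg l q h
      rw [hq] at this
      exact this.false
  have hgij : g i ≠ g j := by
    intro h
    refine hnall (g i) fun l => ?_
    by_cases hl : l = i
    · rw [h]; exact hg j l (hl ▸ hij)
    · exact hg i l hl
  have key : (Finset.univ.filter fun y => y ∉ Z ∧ Dominant r (insert y Z)) = {g i, g j} := by
    ext y
    simp only [Finset.mem_filter, Finset.mem_univ, true_and, Finset.mem_insert,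
      Finset.mem_singleton]
    constructor
    · rintro ⟨hyZ, hy⟩
      obtain ⟨l, hl⟩ := hy y
      have hmem : ∀ x ∈ Z, ∃ l', m l' = x ∧ r l' x < r l' y := by
        intro x hx
        obtain ⟨l', hl'⟩ := hy x
        refine ⟨l', hr l' (le_antisymm (hmin l' x hx)
          (hl' _ (Finset.mem_insert_of_mem (hmZ l')))), lt_of_le_of_ne
            (hl' y (Finset.mem_insert_self _ _)) fun h => hyZ (hr l' h ▸ hx)⟩
      have hneq : ∀ l, r l y ≤ r l (m l) → ∀ x ∈ Z, ∀ l', m l' = x → r l' x < r l' y → l' ≠ l := by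
        rintro l hl x hx l' rfl hlt rfl
        exact hlt.not_ge hl
      have hly := hl _ (Finset.mem_insert_of_mem (hmZ l))
      have hlij := hinj l fun x hx => by
        obtain ⟨l', h1, h2⟩ := hmem x hx
        exact ⟨l', hneq l hly x hx l' h1 h2, h1⟩
      have hyY : ∀ l' ≠ l, r l' (m l') < r l' y := by
        intro l' hl'
        by_contra! hcon
        have hsub : Z ⊆ ((Finset.univ.erase l).erase l').image m := by
          intro x hx
          obtain ⟨q, h1, h2⟩ := hmem x hx
          exact Finset.mem_image.2
            ⟨q, by simp [hneq l hly x hx q h1 h2, hneq l' hcon x hx q h1 h2], h1⟩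
        have := (Finset.card_le_card hsub).trans Finset.card_image_le
        rw [Finset.card_erase_of_mem (by simp [hl']), Finset.card_erase_of_mem (Finset.mem_univ _),
          Finset.card_univ] at this
        have := hne.card_pos
        omega
      have hyg : y = g l := by
        refine hr l (le_antisymm (hgmax l y hyY) ?_)
        obtain ⟨l', hl'⟩ := hy (g l)
        by_cases h : l' = l
        · subst h; exact hl' y (Finset.mem_insert_self _ _)
        · exact absurd (hl' _ (Finset.mem_insert_of_mem (hmZ l'))) (hg l l' h).not_ge
      rcases hlij with rfl | rfl
      · exact Or.inl hyg
      · exact Or.inr hyg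
    · rintro (rfl | rfl)
      · exact ⟨hgZ i j hij hmij, hgdom i⟩
      · exact ⟨hgZ j i hij.symm hmij.symm, hgdom j⟩
  rw [key, Finset.card_pair hgij]
  exact even_two

/-- Scarf's lemma, with slack elements `e i`. -/
theorem exists_dominant_image_eq_univ [Fintype X] [Nonempty I] {r : I → X → ℕ}
    (hr : ∀ i, Function.Injective (r i)) {e : I → X}
    (he : ∀ i x, x ≠ e i → r i (e i) < r i x)
    (he' : ∀ i j x, j ≠ i → x ∉ Set.range e → r i x < r i (e j))
    (hne : ∃ x, x ∉ Set.range e) (c : X → I) (hc : ∀ i, c (e i) = i) :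
    ∃ Z, Z.card = Fintype.card I ∧ Dominant r Z ∧ Z.image c = Finset.univ := by
  classical
  obtain ⟨i₀⟩ := ‹Nonempty I›
  by_contra! hcon
  have heinj : Function.Injective e := fun i j h => by rw [← hc i, h, hc]
  have hce : ∀ s : Finset I, (s.image e).image c = s := fun s => by
    rw [Finset.image_image, show c ∘ e = id from funext hc, Finset.image_id]
  set τ₀ := (Finset.univ.erase i₀).image e with hτ₀
  set rooms := Finset.univ.filter fun Z : Finset X => Z.card = Fintype.card I ∧ Dominant r Z
    with hrooms
  set doors := Finset.univ.filter fun τ : Finset X =>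
    τ.card + 1 = Fintype.card I ∧ τ.image c = Finset.univ.erase i₀ with hdoors
  have hcount := Finset.sum_card_bipartiteAbove_eq_sum_card_bipartiteBelow
    (s := rooms) (t := doors) (fun Z τ => τ ⊆ Z)
  have hroom : ∀ Z ∈ rooms, Even (doors.bipartiteAbove (fun Z τ => τ ⊆ Z) Z).card := by
    intro Z hZ
    obtain ⟨-, hZc, hZd⟩ := Finset.mem_filter.1 hZ
    convert even_card_erase_image_eq hZc c i₀ (hcon Z hZc hZd) using 1
    symm
    apply Finset.card_bij (fun x _ => Z.erase x)
    · intro x hx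
      obtain ⟨hxZ, hx⟩ := Finset.mem_filter.1 hx
      simp only [Finset.bipartiteAbove, hdoors, Finset.mem_filter, Finset.mem_univ, true_and]
      refine ⟨⟨?_, hx⟩, Finset.erase_subset _ _⟩
      rw [Finset.card_erase_add_one hxZ, hZc]
    · intro x hx y hy h
      exact (Finset.erase_inj Z (Finset.mem_filter.1 hx).1).1 h
    · intro τ hτ
      simp only [Finset.bipartiteAbove, hdoors, Finset.mem_filter, Finset.mem_univ, true_and] at hτ
      obtain ⟨⟨h1, h2⟩, h3⟩ := hτ
      obtain ⟨x, hx, rfl⟩ := (Finset.covBy_iff_exists_insert.1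
        (Finset.covBy_iff_card_sdiff_eq_one.2 ⟨h3, by rw [Finset.card_sdiff_of_subset h3]; omega⟩))
      exact ⟨x, by simp [hx, h2], by simp [hx]⟩
  have hdoorcard : ∀ τ ∈ doors, (rooms.bipartiteBelow (fun Z τ => τ ⊆ Z) τ).card =
      (Finset.univ.filter fun y => y ∉ τ ∧ Dominant r (insert y τ)).card := by
    intro τ hτ
    obtain ⟨-, h1, h2⟩ := Finset.mem_filter.1 hτ
    symm
    apply Finset.card_bij (fun y _ => insert y τ)
    · intro y hy
      obtain ⟨-, hy, hd⟩ := Finset.mem_filter.1 hy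
      simp only [Finset.bipartiteBelow, hrooms, Finset.mem_filter, Finset.mem_univ, true_and]
      exact ⟨⟨by rw [Finset.card_insert_of_notMem hy, h1], hd⟩, Finset.subset_insert _ _⟩
    · intro x hx y hy h
      exact (Finset.insert_inj (Finset.mem_filter.1 hx).2.1).1 h
    · intro Z hZ
      simp only [Finset.bipartiteBelow, hrooms, Finset.mem_filter, Finset.mem_univ, true_and] at hZ
      obtain ⟨⟨h3, h4⟩, h5⟩ := hZ
      obtain ⟨x, hx, rfl⟩ := (Finset.covBy_iff_exists_insert.1
        (Finset.covBy_iff_card_sdiff_eq_one.2 ⟨h5, by rw [Finset.card_sdiff_of_subset h5]; omega⟩))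
      exact ⟨x, by simp [hx, h4], rfl⟩
  have hτ₀mem : τ₀ ∈ doors := by
    simp only [hdoors, Finset.mem_filter, Finset.mem_univ, true_and, hτ₀]
    constructor
    · rw [Finset.card_image_of_injective _ heinj, Finset.card_erase_add_one (Finset.mem_univ _),
        Finset.card_univ]
    · exact hce _
  have hdoor : ∀ τ ∈ doors, τ ≠ τ₀ →
      Even (rooms.bipartiteBelow (fun Z τ => τ ⊆ Z) τ).card := by
    intro τ hτ hne0
    rw [hdoorcard τ hτ]
    obtain ⟨-, h1, h2⟩ := Finset.mem_filter.1 hτ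
    by_cases hd : Dominant r τ
    swap
    · rw [Finset.filter_false_of_mem]
      · simp
      · rintro y - ⟨-, h⟩
        exact hd (h.mono (Finset.subset_insert _ _))
    have hlow : ∀ l, ∃ x ∈ τ, x = e l ∨ x ∉ Set.range e := by
      intro l
      by_contra! hl
      have hsub : τ ⊆ (Finset.univ.erase l).image e := by
        intro x hx
        obtain ⟨h3, j, rfl⟩ := hl x hx
        exact Finset.mem_image.2 ⟨j, by
          rw [Finset.mem_erase]
          exact ⟨fun h => h3 (congrArg e h), Finset.mem_univ _⟩, rfl⟩
      have heq : τ = (Finset.univ.erase l).image e := by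
        apply Finset.eq_of_subset_of_card_le hsub
        rw [Finset.card_image_of_injective _ heinj, Finset.card_erase_of_mem (Finset.mem_univ _),
          Finset.card_univ]
        omega
      have him : τ.image c = Finset.univ.erase l := by
        rw [heq, hce]
      rw [h2] at him
      have : i₀ = l := by
        by_contra hil
        have : i₀ ∈ Finset.univ.erase l := by simp [hil]
        rw [← him] at this
        simp at this
      exact hne0 (by rw [heq, hτ₀, this])
    obtain ⟨x, hx, -⟩ := hlow i₀
    refine hd.even_card_insert hr h1 ⟨x, hx⟩ fun i => ⟨e i, fun l hl => ?_⟩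
    obtain ⟨x, hx, h⟩ := hlow l
    refine ⟨x, hx, ?_⟩
    rcases h with rfl | h
    · exact he l _ fun h => hl (heinj h).symm
    · exact he' l i x hl.symm h
  have hdoor₀ : (rooms.bipartiteBelow (fun Z τ => τ ⊆ Z) τ₀).card = 1 := by
    rw [hdoorcard τ₀ hτ₀mem]
    obtain ⟨t, ht, htmax⟩ := (Finset.univ.filter fun x => x ∉ Set.range e).exists_max_image (r i₀)
      (by obtain ⟨x, hx⟩ := hne; exact ⟨x, by simpa using hx⟩)
    replace ht := (Finset.mem_filter.1 ht).2
    replace htmax : ∀ x, x ∉ Set.range e → r i₀ x ≤ r i₀ t := fun x hx =>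
      htmax x (by simpa using hx)
    rw [Finset.card_eq_one]
    refine ⟨t, ?_⟩
    ext y
    simp only [Finset.mem_filter, Finset.mem_univ, true_and, Finset.mem_singleton]
    have hemem : ∀ l, l ≠ i₀ → e l ∈ τ₀ := fun l hl =>
      Finset.mem_image_of_mem _ (by simpa using hl)
    constructor
    · rintro ⟨hy, hd⟩
      have htl : ∀ l, r l (e l) < r l t := fun l => he l t fun h => ht ⟨l, h.symm⟩
      obtain ⟨l, hl⟩ := hd t
      have hli : l = i₀ := by
        by_contra hli
        exact (htl l).not_ge (hl _ (Finset.mem_insert_of_mem (hemem l hli)))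
      subst hli
      have hle := hl y (Finset.mem_insert_self _ _)
      refine hr l (le_antisymm (htmax y ?_) hle)
      rintro ⟨j, rfl⟩
      by_cases hj : j = l
      · subst hj; exact (htl j).not_ge hle
      · exact hy (hemem j hj)
    · rintro rfl
      constructor
      · intro h
        obtain ⟨j, -, h⟩ := Finset.mem_image.1 h
        exact ht ⟨j, h⟩
      · intro z
        by_cases hz : z ∈ Set.range e
        · obtain ⟨j, rfl⟩ := hz
          refine ⟨j, fun x _ => ?_⟩
          by_cases hx : x = e j
          · rw [hx]
          · exact (he j x hx).le
        · refine ⟨i₀, fun x hx => ?_⟩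
          rcases Finset.mem_insert.1 hx with rfl | hx
          · exact htmax z hz
          · obtain ⟨j, hj, rfl⟩ := Finset.mem_image.1 hx
            exact (he' i₀ j z (by simpa using hj) hz).le
  have heven : Even (∑ Z ∈ rooms, (doors.bipartiteAbove (fun Z τ => τ ⊆ Z) Z).card) :=
    Finset.even_sum _ hroom
  rw [hcount, ← Finset.add_sum_erase _ _ hτ₀mem, hdoor₀] at heven
  have := Finset.even_sum (s := doors.erase τ₀)
    (fun τ => (rooms.bipartiteBelow (fun Z τ => τ ⊆ Z) τ).card)
    fun τ hτ => hdoor τ (Finset.mem_of_mem_erase hτ) (Finset.ne_of_mem_erase hτ)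
  rw [Nat.even_add] at heven
  exact absurd (heven.2 this) (by decide)

/-- Scarf's lemma for weak preferences without slack elements. -/
theorem exists_dominant_wrt_image {T : Type*} [Fintype T] [Nonempty T] (r : I → T → ℕ)
    (c : T → I) :
    ∃ σ : Finset T, ∀ y, ∃ i ∈ σ.image c, ∀ x ∈ σ, r i y ≤ r i x := by
  classical
  obtain ⟨t₀⟩ := ‹Nonempty T›
  have : Nonempty I := ⟨c t₀⟩
  let n := Fintype.card T
  let u : T → ℕ := fun t => (Fintype.equivFin T t).1
  have hu : ∀ t, u t < n := fun t => (Fintype.equivFin T t).2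
  have huinj : Function.Injective u := fun a b h =>
    (Fintype.equivFin T).injective (Fin.ext h)
  let v : I → ℕ := fun i => (Fintype.equivFin I i).1
  have hvinj : Function.Injective v := fun a b h =>
    (Fintype.equivFin I).injective (Fin.ext h)
  let ρ : I → T → ℕ := fun i t => n * r i t + u t + 1
  have hρ : ∀ i a b, ρ i a ≤ ρ i b → r i a ≤ r i b := by
    intro i a b h
    by_contra! hlt
    have h1 : n * (r i b + 1) ≤ n * r i a := Nat.mul_le_mul_left _ hlt
    have := hu b
    simp only [ρ] at h
    rw [mul_add] at h1
    omega
  have hρinj : ∀ i, Function.Injective (ρ i) := by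
    intro i a b h
    have h1 := le_antisymm (hρ i a b h.le) (hρ i b a h.ge)
    simp only [ρ, h1] at h
    exact huinj (by omega)
  let M : ℕ := ∑ i, ∑ t, ρ i t
  have hM : ∀ i t, ρ i t ≤ M := fun i t =>
    (Finset.single_le_sum (f := ρ i) (fun _ _ => Nat.zero_le _) (Finset.mem_univ t)).trans
      (Finset.single_le_sum (f := fun i => ∑ t, ρ i t) (fun _ _ => Nat.zero_le _)
        (Finset.mem_univ i))
  let R : I → T ⊕ I → ℕ := fun i => Sum.elim (ρ i) fun j => if j = i then 0 else M + 1 + v j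
  obtain ⟨Z, hZc, hZd, hZi⟩ :=
    exists_dominant_image_eq_univ (r := R) (e := Sum.inr) (c := Sum.elim c id)
    (by
      rintro i (a | a) (b | b) h
      · exact congrArg _ (hρinj i h)
      · have := hM i a
        simp only [R, Sum.elim_inl, Sum.elim_inr] at h
        split_ifs at h
        simp only [ρ] at this h
        omega
      · have := hM i b
        simp only [R, Sum.elim_inl, Sum.elim_inr] at h
        split_ifs at h
        simp only [ρ] at this h
        omega
      · simp only [R, Sum.elim_inr] at h
        split_ifs at h with h1 h2 h2
        · rw [h1, h2]
        · omega
        · omega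
        · exact congrArg _ (hvinj (by omega)))
    (by
      rintro i (a | a) h
      · simp [R, ρ]
      · have : a ≠ i := fun h' => h (h' ▸ rfl)
        simp [R, this])
    (by
      rintro i j (a | a) hj ha
      · have := hM i a
        simp only [R, Sum.elim_inl, Sum.elim_inr, if_neg hj]
        omega
      · simp at ha)
    ⟨Sum.inl t₀, by simp⟩ (fun _ => rfl)
  refine ⟨Finset.univ.filter fun t => Sum.inl t ∈ Z, fun y => ?_⟩
  obtain ⟨i, hi⟩ := hZd (Sum.inl y)
  refine ⟨i, ?_, fun x hx => hρ i y x (hi (Sum.inl x) (by simpa using hx))⟩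
  have : i ∈ Z.image (Sum.elim c id) := by simp [hZi]
  obtain ⟨t | j, hz, hzi⟩ := Finset.mem_image.1 this
  · exact Finset.mem_image.2 ⟨t, by simpa using hz, hzi⟩
  · obtain rfl : j = i := hzi
    have := hi _ hz
    simp [R, ρ] at this

end Scarf

theorem IsCompact.exists_forall_mem_of_dist_le {E ι : Type*} [PseudoMetricSpace E] {K : Set E}
    (hK : IsCompact K) {F : ι → Set E} (hF : ∀ i, IsClosed (F i))
    (h : ∀ ε > 0, ∃ x ∈ K, ∀ i, ∃ p ∈ F i, dist x p ≤ ε) : ∃ x ∈ K, ∀ i, x ∈ F i := by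
  choose x hxK hx using fun n : ℕ => h (1 / ((n : ℝ) + 1)) Nat.one_div_pos_of_nat
  obtain ⟨a, haK, φ, hφ, hlim⟩ := hK.tendsto_subseq hxK
  refine ⟨a, haK, fun i => ?_⟩
  choose p hpF hp using fun n => hx n i
  have hp0 : Filter.Tendsto (fun n => dist ((x ∘ φ) n) (p (φ n))) Filter.atTop (nhds 0) :=
    squeeze_zero (fun _ => dist_nonneg) (fun n => hp (φ n))
      (tendsto_one_div_add_atTop_nhds_zero_nat.comp hφ.tendsto_atTop)
  exact (hF i).mem_of_tendsto ((tendsto_iff_of_dist hp0).1 hlim)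
    (Filter.Eventually.of_forall fun n => hpF _)

theorem exists_grid_approx {I : Type*} [Fintype I] [Nonempty I] [DecidableEq I] (N : ℕ)
    (c : (I → ℕ) → I) :
    ∃ (σ : Finset (I → ℕ)) (x₀ : I → ℕ), σ ⊆ Finset.piAntidiag Finset.univ N ∧ x₀ ∈ σ ∧
      (∀ x ∈ σ, ∀ l, x₀ l ≤ x l + Fintype.card I ∧ x l ≤ x₀ l + Fintype.card I) ∧
      ∀ i ∉ σ.image c, x₀ i ≤ Fintype.card I := by
  classical
  obtain ⟨i₀⟩ := ‹Nonempty I›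
  let G : Finset (I → ℕ) := Finset.piAntidiag Finset.univ N
  have hG : ∀ m, m ∈ G ↔ ∑ i, m i = N := fun m => by simp [G]
  have hs : Pi.single i₀ N ∈ G := by simp [hG]
  have : Nonempty G := ⟨⟨_, hs⟩⟩
  obtain ⟨σ', hσ'⟩ := exists_dominant_wrt_image (T := G) (fun i m => m.1 i) (fun m => c m.1)
  set σ := σ'.map (Function.Embedding.subtype _) with hσdef
  have hσG : ∀ x ∈ σ, ∑ i, x i = N := fun x hx => by
    obtain ⟨m, -, rfl⟩ := Finset.mem_map.1 hx
    exact (hG _).1 m.2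
  have hσ : ∀ y : I → ℕ, ∑ i, y i = N → ∃ i ∈ σ.image c, ∀ x ∈ σ, y i ≤ x i := by
    intro y hy
    obtain ⟨i, hi, h⟩ := hσ' ⟨y, (hG y).2 hy⟩
    refine ⟨i, ?_, fun x hx => ?_⟩
    · obtain ⟨m, hm, rfl⟩ := Finset.mem_image.1 hi
      exact Finset.mem_image_of_mem c (Finset.mem_map_of_mem _ hm)
    · obtain ⟨m, hm, rfl⟩ := Finset.mem_map.1 hx
      exact h m hm
  obtain ⟨i₁, hi₁, -⟩ := hσ _ ((hG _).1 hs)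
  obtain ⟨x₀, hx₀, -⟩ := Finset.mem_image.1 hi₁
  choose w hwσ hw using fun i => σ.exists_min_image (fun x => x i) ⟨x₀, hx₀⟩
  set C := σ.image c
  have hCcard : C.card ≤ Fintype.card I := Finset.card_le_univ C
  have hN : N < ∑ i ∈ C, w i i + C.card := by
    by_contra! hcon
    have hcon' : ∑ i ∈ C, (w i i + 1) ≤ N := by
      rwa [Finset.sum_add_distrib, Finset.sum_const, smul_eq_mul, mul_one]
    obtain ⟨i, hi, h⟩ := hσ (fun i => (if i ∈ C then w i i + 1 else 0) +
        if i = i₁ then N - ∑ i ∈ C, (w i i + 1) else 0) (by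
      rw [Finset.sum_add_distrib, ← Finset.sum_filter, Finset.sum_ite_eq']
      simp only [Finset.filter_univ_mem, Finset.mem_univ, if_true]
      omega)
    have := h _ (hwσ i)
    simp only [hi, if_true] at this
    omega
  have hbound : ∀ x ∈ σ, (∀ l ∈ C, x l ≤ w l l + Fintype.card I) ∧
      ∀ l ∉ C, x l ≤ Fintype.card I := by
    intro x hx
    have hxN := hσG x hx
    constructor
    · intro l hl
      have h1 : ∑ i ∈ C, x i ≤ N := hxN ▸ Finset.sum_le_sum_of_subset (Finset.subset_univ C)
      rw [← Finset.add_sum_erase _ _ hl] at h1 hN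
      have h2 : ∑ i ∈ C.erase l, w i i ≤ ∑ i ∈ C.erase l, x i :=
        Finset.sum_le_sum fun i _ => hw i x hx
      omega
    · intro l hl
      have h1 : ∑ i ∈ insert l C, x i ≤ N :=
        hxN ▸ Finset.sum_le_sum_of_subset (Finset.subset_univ _)
      rw [Finset.sum_insert hl] at h1
      have h2 : ∑ i ∈ C, w i i ≤ ∑ i ∈ C, x i := Finset.sum_le_sum fun i _ => hw i x hx
      omega
  refine ⟨σ, x₀, fun x hx => (hG x).2 (hσG x hx), hx₀, fun x hx l => ?_, (hbound x₀ hx₀).2⟩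
  by_cases hl : l ∈ C
  · have h1 := (hbound x hx).1 l hl
    have h2 := (hbound x₀ hx₀).1 l hl
    have h3 := hw l x hx
    have h4 := hw l x₀ hx₀
    omega
  · have h1 := (hbound x hx).2 l hl
    have h2 := (hbound x₀ hx₀).2 l hl
    omega

theorem div_mem_stdSimplex {I : Type*} [Fintype I] {N : ℕ} (hN : 0 < N) {m : I → ℕ}
    (hm : ∑ i, m i = N) : (fun i => (m i : ℝ) / N) ∈ stdSimplex ℝ I := by
  refine ⟨fun i => by positivity, ?_⟩
  rw [← Finset.sum_div, ← Nat.cast_sum, hm]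
  exact div_self (by positivity)

/-- A dual form of the KKM lemma: closed sets covering the simplex, each containing the
opposite facet, have a common point. -/
theorem exists_mem_of_facet_subset {I : Type*} [Fintype I] [Nonempty I] {P : I → Set (I → ℝ)}
    (hP : ∀ i, IsClosed (P i)) (hcover : ∀ x ∈ stdSimplex ℝ I, ∃ i, x ∈ P i)
    (hfacet : ∀ i, ∀ x ∈ stdSimplex ℝ I, x i = 0 → x ∈ P i) :
    ∃ x ∈ stdSimplex ℝ I, ∀ i, x ∈ P i := by
  classical
  suffices ∃ x ∈ stdSimplex ℝ I, ∀ i, x ∈ P i ∪ {x | x i = 0} by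
    obtain ⟨x, hx, h⟩ := this
    exact ⟨x, hx, fun i => (h i).elim id (hfacet i x hx)⟩
  apply (isCompact_stdSimplex ℝ I).exists_forall_mem_of_dist_le
    fun i => (hP i).union (isClosed_eq (continuous_apply i) continuous_const)
  intro ε hε
  obtain ⟨N, hN⟩ := exists_nat_gt (Fintype.card I / ε)
  have hNpos : (0 : ℝ) < N := lt_of_le_of_lt (by positivity) hN
  have hNε : (Fintype.card I : ℝ) / N ≤ ε := by
    rw [div_lt_iff₀ hε] at hN
    rw [div_le_iff₀ hNpos]
    linarith
  have hc : ∀ m : I → ℕ, ∃ i, ∑ i, m i = N → (fun i => (m i : ℝ) / N) ∈ P i := by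
    intro m
    by_cases hm : ∑ i, m i = N
    · obtain ⟨i, hi⟩ := hcover _ (div_mem_stdSimplex (Nat.cast_pos.1 hNpos) hm)
      exact ⟨i, fun _ => hi⟩
    · exact ⟨Classical.arbitrary I, fun h => absurd h hm⟩
  choose c hc using hc
  obtain ⟨σ, x₀, hσ, hx₀, hnear, hfar⟩ := exists_grid_approx N c
  have hσN : ∀ x ∈ σ, ∑ i, x i = N := fun x hx => by simpa using hσ hx
  refine ⟨_, div_mem_stdSimplex (Nat.cast_pos.1 hNpos) (hσN x₀ hx₀), fun i => ?_⟩
  by_cases hi : i ∈ σ.image c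
  · obtain ⟨x, hx, rfl⟩ := Finset.mem_image.1 hi
    refine ⟨_, Or.inl (hc x (hσN x hx)), (dist_pi_le_iff hε.le).2 fun l => ?_⟩
    obtain ⟨h1, h2⟩ := hnear x hx l
    have h1' : (x₀ l : ℝ) ≤ x l + Fintype.card I := by exact_mod_cast h1
    have h2' : (x l : ℝ) ≤ x₀ l + Fintype.card I := by exact_mod_cast h2
    refine le_trans ?_ hNε
    rw [Real.dist_eq, ← sub_div, abs_div, abs_of_pos hNpos]
    gcongr
    rw [abs_le]
    constructor <;> linarith
  · refine ⟨Function.update (fun i => (x₀ i : ℝ) / N) i 0, Or.inr (by simp),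
      (dist_pi_le_iff hε.le).2 fun l => ?_⟩
    by_cases hl : l = i
    · subst hl
      have h1 : (x₀ l : ℝ) ≤ Fintype.card I := by exact_mod_cast hfar l hi
      rw [Function.update_self, Real.dist_eq, sub_zero, abs_of_nonneg (by positivity)]
      exact le_trans (by gcongr) hNε
    · rw [Function.update_of_ne hl, dist_self]
      exact hε.le

section Grid

/-- The sum of the first `a` entries of `f`. -/
def prefixSum {n : ℕ} {M : Type*} [AddCommMonoid M] (f : Fin n → M) (a : ℕ) : M :=
  ∑ j with j.val < a, f j

theorem prefixSum_zero {n : ℕ} {M : Type*} [AddCommMonoid M] (f : Fin n → M) :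
    prefixSum f 0 = 0 := by
  simp [prefixSum]

theorem prefixSum_succ {n : ℕ} {M : Type*} [AddCommMonoid M] (f : Fin n → M) (j : Fin n) :
    prefixSum f (j + 1) = prefixSum f j + f j := by
  have : (Finset.univ.filter fun i : Fin n => i.val < j + 1) =
      insert j (Finset.univ.filter fun i : Fin n => i.val < j) := by
    ext i
    simp only [Finset.mem_filter, Finset.mem_univ, true_and, Finset.mem_insert, Fin.ext_iff]
    omega
  rw [prefixSum, this, Finset.sum_insert (by simp), add_comm, prefixSum]

theorem prefixSum_self {n : ℕ} {M : Type*} [AddCommMonoid M] (f : Fin n → M) :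
    prefixSum f n = ∑ j, f j := by
  simp [prefixSum]

theorem continuous_prefixSum {n : ℕ} (a : ℕ) :
    Continuous fun x : Fin n → ℝ => prefixSum x a := by
  unfold prefixSum
  fun_prop

variable {n : ℕ}

/-- The difference of the prefix sums of `N • x` and of the grid point `m`. -/
def gridDev (N : ℕ) (m : Fin n → ℕ) (x : Fin n → ℝ) (a : ℕ) : ℝ :=
  N * prefixSum x a - prefixSum m a

/-- A bump function around the grid point `m / N`, positive on the open star of `m / N` in the
Kuhn triangulation. -/
def gridBump (N : ℕ) (m : Fin n → ℕ) (x : Fin n → ℝ) : ℝ :=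
  ∏ a ∈ Finset.range (n + 1), ∏ b ∈ Finset.range (n + 1),
    max 0 (1 - (gridDev N m x a - gridDev N m x b))

/-- The colour of a grid point, injective on the vertices of each Kuhn simplex. -/
def gridColor {k : ℕ} (m : Fin (k + 1) → ℕ) : Fin (k + 1) :=
  ⟨(∑ a ∈ Finset.range (k + 1), prefixSum m a) % (k + 1), Nat.mod_lt _ k.succ_pos⟩

theorem continuous_gridBump (N : ℕ) (m : Fin n → ℕ) : Continuous (gridBump N m) := by
  unfold gridBump gridDev
  have := fun a => continuous_prefixSum (n := n) a
  fun_prop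

theorem gridBump_nonneg (N : ℕ) (m : Fin n → ℕ) (x : Fin n → ℝ) : 0 ≤ gridBump N m x :=
  Finset.prod_nonneg fun _ _ => Finset.prod_nonneg fun _ _ => le_max_left _ _

theorem gridBump_pos_iff {N : ℕ} {m : Fin n → ℕ} {x : Fin n → ℝ} :
    0 < gridBump N m x ↔ ∀ a ≤ n, ∀ b ≤ n, gridDev N m x a - gridDev N m x b < 1 := by
  constructor
  · intro h a ha b hb
    by_contra! hcon
    refine h.ne' (Finset.prod_eq_zero (Finset.mem_range_succ_iff.2 ha)
      (Finset.prod_eq_zero (Finset.mem_range_succ_iff.2 hb) (max_eq_left ?_)))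
    linarith
  · intro h
    refine Finset.prod_pos fun a ha => Finset.prod_pos fun b hb => lt_max_of_lt_right ?_
    linarith [h a (Finset.mem_range_succ_iff.1 ha) b (Finset.mem_range_succ_iff.1 hb)]

theorem abs_sub_lt_one_of_gridBump_pos {N : ℕ} {m : Fin n → ℕ} {x : Fin n → ℝ}
    (h : 0 < gridBump N m x) (j : Fin n) : |N * x j - m j| < 1 := by
  rw [gridBump_pos_iff] at h
  have h1 := h (j + 1) j.2 j j.2.le
  have h2 := h j j.2.le (j + 1) j.2
  simp only [gridDev, prefixSum_succ, Nat.cast_add, mul_add] at h1 h2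
  rw [abs_lt]
  constructor <;> linarith

theorem eq_zero_of_gridBump_pos {N : ℕ} {m : Fin n → ℕ} {x : Fin n → ℝ}
    (h : 0 < gridBump N m x) {j : Fin n} (hj : x j = 0) : m j = 0 := by
  have := abs_sub_lt_one_of_gridBump_pos h j
  rw [hj, mul_zero, zero_sub, abs_neg, Nat.abs_cast] at this
  exact_mod_cast Nat.lt_one_iff.1 (by exact_mod_cast this)

theorem exists_gridBump_pos (N : ℕ) {x : Fin n → ℝ} (hx : x ∈ stdSimplex ℝ (Fin n)) :
    ∃ m : Fin n → ℕ, ∑ j, m j = N ∧ 0 < gridBump N m x := by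
  let z : ℕ → ℕ := fun a => ⌊N * prefixSum x a⌋₊
  have hz : Monotone z := fun a b hab => Nat.floor_mono <| mul_le_mul_of_nonneg_left
    (Finset.sum_le_sum_of_subset_of_nonneg
      (Finset.monotone_filter_right _ fun _ _ h => lt_of_lt_of_le h hab) fun i _ _ => hx.1 i)
    N.cast_nonneg
  let m : Fin n → ℕ := fun j => z (j + 1) - z j
  have hm : ∀ a ≤ n, prefixSum m a = z a := by
    intro a
    induction a with
    | zero => intro _; simp [z, prefixSum_zero]
    | succ a ih =>
      intro ha
      have := prefixSum_succ m ⟨a, ha⟩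
      simp only at this
      rw [this, ih (by omega)]
      exact Nat.add_sub_cancel' (hz a.le_succ)
  refine ⟨m, ?_, ?_⟩
  · rw [← prefixSum_self, hm n le_rfl]
    simp only [z]
    rw [prefixSum_self, hx.2, mul_one, Nat.floor_natCast]
  · rw [gridBump_pos_iff]
    intro a ha b hb
    have hnn : (0 : ℝ) ≤ N * prefixSum x b :=
      mul_nonneg N.cast_nonneg (Finset.sum_nonneg fun i _ => hx.1 i)
    simp only [gridDev, hm a ha, hm b hb, z]
    linarith [Nat.lt_floor_add_one (N * prefixSum x a), Nat.floor_le hnn]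

theorem eq_zero_of_dvd_sum_range {δ : ℕ → ℤ} {n : ℕ} (hn : 0 < n) (h0 : δ 0 = 0)
    (h : ∀ a < n, 0 ≤ δ a ∧ δ a ≤ 1) (hdvd : (n : ℤ) ∣ ∑ a ∈ Finset.range n, δ a) :
    ∀ a < n, δ a = 0 := by
  have hnn : ∀ a ∈ Finset.range n, 0 ≤ δ a := fun a ha => (h a (Finset.mem_range.1 ha)).1
  have hlt : ∑ a ∈ Finset.range n, δ a < n := by
    calc ∑ a ∈ Finset.range n, δ a < ∑ a ∈ Finset.range n, (1 : ℤ) :=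
          Finset.sum_lt_sum (fun a ha => (h a (Finset.mem_range.1 ha)).2)
            ⟨0, Finset.mem_range.2 hn, by rw [h0]; exact one_pos⟩
      _ = n := by simp
  have hsum := Int.eq_zero_of_dvd_of_nonneg_of_lt (Finset.sum_nonneg hnn) hlt hdvd
  exact fun a ha => (Finset.sum_eq_zero_iff_of_nonneg hnn).1 hsum a (Finset.mem_range.2 ha)

theorem eq_of_gridColor_eq {k N : ℕ} {m m' : Fin (k + 1) → ℕ} {x : Fin (k + 1) → ℝ}
    (hm : ∑ j, m j = N) (hm' : ∑ j, m' j = N) (h : 0 < gridBump N m x)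
    (h' : 0 < gridBump N m' x) (hcol : gridColor m = gridColor m') : m = m' := by
  rw [gridBump_pos_iff] at h h'
  let δ : ℕ → ℤ := fun a => ((prefixSum m a : ℕ) : ℤ) - (prefixSum m' a : ℕ)
  have h0 : δ 0 = 0 := by simp [δ, prefixSum_zero]
  have hδ : ∀ a ≤ k + 1, ∀ b ≤ k + 1, δ a - δ b ≤ 1 := by
    intro a ha b hb
    have h1 := h b hb a ha
    have h2 := h' a ha b hb
    have : ((δ a - δ b : ℤ) : ℝ) < 2 := by
      simp only [gridDev] at h1 h2
      simp only [δ]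
      push_cast
      linarith
    have : δ a - δ b < 2 := by exact_mod_cast this
    omega
  have hdvd : ((k + 1 : ℕ) : ℤ) ∣ ∑ a ∈ Finset.range (k + 1), δ a := by
    have h3 : (∑ a ∈ Finset.range (k + 1), prefixSum m' a) ≡
        (∑ a ∈ Finset.range (k + 1), prefixSum m a) [MOD (k + 1)] := (Fin.ext_iff.1 hcol).symm
    have := (Nat.modEq_iff_dvd.1 h3)
    simpa [δ] using this
  have hzero : ∀ a < k + 1, δ a = 0 := by
    by_cases hpos : ∃ a < k + 1, 0 < δ a
    · obtain ⟨a, ha, hpos⟩ := hpos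
      refine eq_zero_of_dvd_sum_range k.succ_pos h0 (fun b hb => ⟨?_, ?_⟩) hdvd
      · have := hδ a ha.le b hb.le
        omega
      · have := hδ b hb.le 0 (by omega)
        omega
    · push Not at hpos
      have := eq_zero_of_dvd_sum_range (δ := fun a => - δ a) k.succ_pos (by simp [h0])
        (fun b hb => ⟨by have := hpos b hb; omega, by have := hδ 0 (by omega) b hb.le; omega⟩)
        (by rw [Finset.sum_neg_distrib]; exact (dvd_neg).2 hdvd)
      exact fun a ha => neg_eq_zero.1 (this a ha)
  have hpre : ∀ a ≤ k + 1, prefixSum m a = prefixSum m' a := by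
    intro a ha
    rcases ha.lt_or_eq with ha | rfl
    · have := hzero a ha
      simp only [δ] at this
      omega
    · rw [prefixSum_self, prefixSum_self, hm, hm']
  funext j
  have h1 := prefixSum_succ m j
  have h2 := prefixSum_succ m' j
  rw [hpre _ j.2, hpre _ j.2.le] at h1
  exact Nat.add_left_cancel (h1.symm.trans h2)

end Grid

theorem sum_faceBarycenter {k : ℕ} {S : Finset (Fin (k + 1))} (hS : S.Nonempty) :
    ∑ i, faceBarycenter k S i = 1 := by
  simp only [faceBarycenter, ← Finset.sum_filter, Finset.filter_univ_mem, Finset.sum_const,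
    nsmul_eq_mul]
  exact mul_inv_cancel₀ (by exact_mod_cast hS.card_pos.ne')

theorem exists_balanced_dist_le {k : ℕ}
    {A : Fin (k + 1) → Finset (Fin (k + 1)) → Set (Fin (k + 1) → ℝ)}
    (hcover : ∀ i, ∀ S : Finset (Fin (k + 1)), S.Nonempty →
      simplexFace k S ⊆ ⋃ T ∈ {T : Finset (Fin (k + 1)) | T.Nonempty ∧ T ⊆ S}, A i T)
    {N : ℕ} (hN : 0 < N) :
    ∃ Ts : Fin (k + 1) → Finset (Fin (k + 1)), (∀ i, (Ts i).Nonempty) ∧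
      (fun _ => ((k : ℝ) + 1)⁻¹) ∈ convexHull ℝ (Set.range fun i => faceBarycenter k (Ts i)) ∧
      ∃ x ∈ stdSimplex ℝ (Fin (k + 1)), ∀ i, ∃ p ∈ A i (Ts i), dist x p ≤ 1 / N := by
  classical
  have hNpos : (0 : ℝ) < N := Nat.cast_pos.2 hN
  have hface : ∀ i, ∀ S : Finset (Fin (k + 1)), S.Nonempty → ∀ x ∈ stdSimplex ℝ (Fin (k + 1)),
      (∀ j ∉ S, x j = 0) → ∃ T ⊆ S, T.Nonempty ∧ x ∈ A i T := by
    intro i S hS x hx h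
    have := hcover i S hS ⟨hx, h⟩
    simp only [Set.mem_iUnion, Set.mem_ofPred_eq] at this
    obtain ⟨T, ⟨h1, h2⟩, h3⟩ := this
    exact ⟨T, h2, h1, h3⟩
  have hT : ∀ m : Fin (k + 1) → ℕ, ∃ T : Finset (Fin (k + 1)), ∑ j, m j = N →
      T.Nonempty ∧ (∀ j ∈ T, m j ≠ 0) ∧ (fun j => (m j : ℝ) / N) ∈ A (gridColor m) T := by
    intro m
    by_cases hm : ∑ j, m j = N
    · obtain ⟨j, -, hj⟩ := Finset.exists_ne_zero_of_sum_ne_zero (hm.trans_ne hN.ne')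
      obtain ⟨T, h1, h2, h3⟩ := hface (gridColor m) (Finset.univ.filter fun j => m j ≠ 0)
        ⟨j, by simpa using hj⟩ _ (div_mem_stdSimplex hN hm) (fun j hj => by
          simp only [Finset.mem_filter, Finset.mem_univ, true_and, not_not] at hj
          simp [hj])
      exact ⟨T, fun _ => ⟨h2, fun j hj => (Finset.mem_filter.1 (h1 hj)).2, h3⟩⟩
    · exact ⟨∅, fun h => absurd h hm⟩
  choose T hT using hT
  let G : Finset (Fin (k + 1) → ℕ) := Finset.piAntidiag Finset.univ N
  have hG : ∀ m, m ∈ G ↔ ∑ j, m j = N := fun m => by simp [G]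
  let F : Fin (k + 1) → (Fin (k + 1) → ℝ) → ℝ := fun i x =>
    ∑ m ∈ G, gridBump N m x * (faceBarycenter k (T m) i - ((k : ℝ) + 1)⁻¹)
  have hFsum : ∀ x, ∑ i, F i x = 0 := by
    intro x
    simp only [F]
    rw [Finset.sum_comm]
    refine Finset.sum_eq_zero fun m hm => ?_
    rw [← Finset.mul_sum, Finset.sum_sub_distrib, sum_faceBarycenter (hT m ((hG m).1 hm)).1]
    simp only [Finset.sum_const, Finset.card_univ, Fintype.card_fin, nsmul_eq_mul, Nat.cast_add,
      Nat.cast_one]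
    rw [mul_inv_cancel₀ (by positivity), sub_self, mul_zero]
  obtain ⟨x, hx, hxF⟩ := exists_mem_of_facet_subset (P := fun i => {x | F i x ≤ 0})
    (fun i => isClosed_le (continuous_finsetSum _ fun m _ =>
      (continuous_gridBump N m).mul continuous_const) continuous_const)
    (fun x _ => by
      by_contra! hcon
      have hpos : 0 < ∑ i, F i x :=
        Finset.sum_pos (fun i _ => by simpa using hcon i) Finset.univ_nonempty
      exact hpos.ne' (hFsum x))
    (fun i x _ hxi => by
      show F i x ≤ 0
      refine Finset.sum_nonpos fun m hm => ?_
      rcases (gridBump_nonneg N m x).eq_or_lt with h | h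
      · rw [← h, zero_mul]
      · have hi : i ∉ T m := fun hi =>
          (hT m ((hG m).1 hm)).2.1 i hi (eq_zero_of_gridBump_pos h hxi)
        refine mul_nonpos_of_nonneg_of_nonpos h.le ?_
        rw [faceBarycenter, if_neg hi, zero_sub, neg_nonpos]
        positivity)
  have hF0 : ∀ i, F i x = 0 := fun i =>
    (Finset.sum_eq_zero_iff_of_nonpos fun i _ => hxF i).1 (hFsum x) i (Finset.mem_univ i)
  let W := G.filter fun m => 0 < gridBump N m x
  have hW : ∀ m ∈ W, ∑ j, m j = N ∧ 0 < gridBump N m x := fun m hm =>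
    ⟨(hG m).1 (Finset.mem_filter.1 hm).1, (Finset.mem_filter.1 hm).2⟩
  have hTs : ∀ i, ∃ S : Finset (Fin (k + 1)), S.Nonempty ∧
      (∀ m ∈ W, gridColor m = i → T m = S) ∧ ∃ p ∈ A i S, dist x p ≤ 1 / N := by
    intro i
    by_cases h : ∃ m ∈ W, gridColor m = i
    · obtain ⟨m, hm, rfl⟩ := h
      obtain ⟨hmN, hpos⟩ := hW m hm
      refine ⟨T m, (hT m hmN).1, fun m' hm' hc => ?_, _, (hT m hmN).2.2,
        (dist_pi_le_iff (by positivity)).2 fun j => ?_⟩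
      · obtain ⟨hmN', hpos'⟩ := hW m' hm'
        rw [eq_of_gridColor_eq hmN' hmN hpos' hpos hc]
      · have hj := (abs_sub_lt_one_of_gridBump_pos hpos j).le
        have : x j - m j / N = (N * x j - m j) / N := by field_simp
        rw [Real.dist_eq, this, abs_div, abs_of_pos hNpos]
        gcongr
    · push Not at h
      obtain ⟨S, -, h2, h3⟩ := hface i Finset.univ Finset.univ_nonempty x hx (by simp)
      exact ⟨S, h2, fun m hm hc => absurd hc (h m hm), x, h3, by rw [dist_self]; positivity⟩
  choose Ts hTne hTW hTp using hTs
  refine ⟨Ts, hTne, ?_, x, hx, hTp⟩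
  have hpos : 0 < ∑ m ∈ W, gridBump N m x := by
    obtain ⟨m, hm, hmpos⟩ := exists_gridBump_pos N hx
    exact Finset.sum_pos (fun m hm => (hW m hm).2)
      ⟨m, Finset.mem_filter.2 ⟨(hG m).2 hm, hmpos⟩⟩
  have hmem : ∀ m ∈ W, faceBarycenter k (T m) ∈ Set.range fun i => faceBarycenter k (Ts i) :=
    fun m hm => ⟨gridColor m, congrArg _ (hTW _ m hm rfl).symm⟩
  convert W.centerMass_mem_convexHull (fun m _ => gridBump_nonneg N m x) hpos hmem using 1
  funext i
  have hWF : ∑ m ∈ W, gridBump N m x * (faceBarycenter k (T m) i - ((k : ℝ) + 1)⁻¹) = 0 := by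
    rw [← hF0 i]
    refine Finset.sum_filter_of_ne fun m _ h => ?_
    exact (gridBump_nonneg N m x).lt_of_ne fun h0 => h (by rw [← h0, zero_mul])
  simp only [mul_sub, Finset.sum_sub_distrib, ← Finset.sum_mul] at hWF
  simp only [Finset.centerMass, Pi.smul_apply, Finset.sum_apply, smul_eq_mul]
  rw [eq_comm, inv_mul_eq_iff_eq_mul₀ hpos.ne']
  linarith

/-- **The colorful KKMS theorem of Shih and Lee.** Given `k+1` KKMS covers
`{A i T : T nonempty subset of [k+1]}` (for `i ∈ [k+1]`) of the standard `k`-simplex by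
closed sets, there is a balanced collection `T 1, …, T (k+1)` of nonempty subsets of
`[k+1]` such that `⋂ i, A i (T i) ≠ ∅`. -/
theorem colorful_KKMS (k : ℕ) (A : Fin (k + 1) → Finset (Fin (k + 1)) → Set (Fin (k + 1) → ℝ))
    (hclosed : ∀ i, ∀ T : Finset (Fin (k + 1)), T.Nonempty → IsClosed (A i T))
    (hsub : ∀ i, ∀ T : Finset (Fin (k + 1)), T.Nonempty → A i T ⊆ stdSimplex ℝ (Fin (k + 1)))
    (hcover : ∀ i, ∀ S : Finset (Fin (k + 1)), S.Nonempty →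
      simplexFace k S ⊆ ⋃ T ∈ {T : Finset (Fin (k + 1)) | T.Nonempty ∧ T ⊆ S}, A i T) :
    ∃ Ts : Fin (k + 1) → Finset (Fin (k + 1)),
      (∀ i, (Ts i).Nonempty) ∧
      (fun _ => ((k : ℝ) + 1)⁻¹) ∈ convexHull ℝ (Set.range fun i => faceBarycenter k (Ts i)) ∧
      (⋂ i, A i (Ts i)).Nonempty := by
  by_contra hcon
  have hfail : ∀ Ts : Fin (k + 1) → Finset (Fin (k + 1)), ∃ ε > 0, (∀ i, (Ts i).Nonempty) →
      (fun _ => ((k : ℝ) + 1)⁻¹) ∈ convexHull ℝ (Set.range fun i => faceBarycenter k (Ts i)) →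
      ¬ ∃ x ∈ stdSimplex ℝ (Fin (k + 1)), ∀ i, ∃ p ∈ A i (Ts i), dist x p ≤ ε := by
    intro Ts
    by_contra! h
    obtain ⟨hne, hbal, -⟩ := h 1 one_pos
    obtain ⟨x, -, hx⟩ := (isCompact_stdSimplex ℝ (Fin (k + 1))).exists_forall_mem_of_dist_le
      (fun i => hclosed i (Ts i) (hne i)) fun ε hε => (h ε hε).2.2
    exact hcon ⟨Ts, hne, hbal, x, Set.mem_iInter.2 hx⟩
  choose ε hε hfail using hfail
  obtain ⟨Ts₀, hmin⟩ := Finite.exists_min ε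
  obtain ⟨N, hN⟩ := exists_nat_one_div_lt (hε Ts₀)
  obtain ⟨Ts, hne, hbal, x, hx, hp⟩ := exists_balanced_dist_le hcover N.succ_pos
  refine hfail Ts hne hbal ⟨x, hx, fun i => ?_⟩
  obtain ⟨p, hpA, hd⟩ := hp i
  refine ⟨p, hpA, hd.trans (le_trans ?_ (hmin Ts))⟩
  rw [Nat.cast_succ]
  exact hN.le
end

section
/- In every hypergraph H of separated d-intervals (d ≥ 2), the covering number satisfies τ(H) ≤ (d² − d)·ν(H). -/
/-- A `d`-interval: a union of at most `d` (and at least one) pairwise disjoint nonempty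
closed intervals in `ℝ`. -/
def IsDInterval (d : ℕ) (h : Set ℝ) : Prop :=
  ∃ (n : ℕ) (a b : Fin n → ℝ), 1 ≤ n ∧ n ≤ d ∧ (∀ i, a i ≤ b i) ∧
    (∀ i j : Fin n, i ≠ j → Disjoint (Set.Icc (a i) (b i)) (Set.Icc (a j) (b j))) ∧
    h = ⋃ i, Set.Icc (a i) (b i)

/-- A separated `d`-interval: `d` disjoint nonempty closed interval components, the `i`-th
component (for `i ∈ {0, …, d-1}`) lying in the open interval `(i, i+1)`. -/
def IsSeparatedDInterval (d : ℕ) (h : Set ℝ) : Prop :=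
  ∃ a b : Fin d → ℝ, (∀ i, a i ≤ b i) ∧
    (∀ i : Fin d, Set.Icc (a i) (b i) ⊆ Set.Ioo (i : ℝ) ((i : ℝ) + 1)) ∧
    h = ⋃ i, Set.Icc (a i) (b i)

/-- `C` is a cover (piercing set) of the hypergraph with edge set `F`: every edge contains
a point of `C`. -/
def IsCover (F : Finset (Set ℝ)) (C : Finset ℝ) : Prop :=
  ∀ e ∈ F, ∃ p ∈ C, p ∈ e

/-- The covering (piercing) number `τ`: the minimal size of a cover. -/
noncomputable def piercingNumber (F : Finset (Set ℝ)) : ℕ :=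
  sInf {n : ℕ | ∃ C : Finset ℝ, IsCover F C ∧ C.card = n}

/-- `M` is a matching of the hypergraph with edge set `F`: a set of pairwise disjoint
edges of `F`. -/
def IsMatching (F M : Finset (Set ℝ)) : Prop :=
  M ⊆ F ∧ ∀ e ∈ M, ∀ f ∈ M, e ≠ f → Disjoint e f

/-- The matching number `ν`: the maximal size of a matching. -/
noncomputable def matchingNumber (F : Finset (Set ℝ)) : ℕ :=
  sSup {n : ℕ | ∃ M : Finset (Set ℝ), IsMatching F M ∧ M.card = n}

/-- `S` is dominating for the family of rankings `r` if every point is ranked, by one of the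
rankings, below all points of `S`. -/
def IsDominating {I P : Type*} (r : I → P → ℕ) (S : Finset P) : Prop :=
  ∀ y, ∃ i, ∀ x ∈ S, r i y ≤ r i x

/-- `x` is the `r a`-highest point among those lying strictly above `μ i` in every ranking
`r i` with `i ≠ a`. -/
def IsReplacement {I P : Type*} (r : I → P → ℕ) (μ : I → P) (a : I) (x : P) : Prop :=
  (∀ i, i ≠ a → r i (μ i) < r i x) ∧
    ∀ y, (∀ i, i ≠ a → r i (μ i) < r i y) → r a y ≤ r a x

theorem IsDominating.mono {I P : Type*} {r : I → P → ℕ} {S T : Finset P}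
    (hT : IsDominating r T) (h : S ⊆ T) : IsDominating r S := fun y =>
  (hT y).imp fun _ hi x hx => hi x (h hx)

theorem IsReplacement.eq {I P : Type*} {r : I → P → ℕ} (hr : ∀ i, Function.Injective (r i))
    {μ : I → P} {a : I} {x y : P} (hx : IsReplacement r μ a x) (hy : IsReplacement r μ a y) :
    x = y :=
  hr a (le_antisymm (hy.2 x hx.1) (hx.2 y hy.1))

theorem exists_isReplacement {I P : Type*} [Finite P] {r : I → P → ℕ} {μ : I → P} {a : I} {y : P}
    (hy : ∀ i, i ≠ a → r i (μ i) < r i y) : ∃ x, IsReplacement r μ a x := by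
  obtain ⟨x, hx, hmax⟩ := Set.exists_max_image {y | ∀ i, i ≠ a → r i (μ i) < r i y} (r a)
    (Set.toFinite _) ⟨y, hy⟩
  exact ⟨x, hx, hmax⟩

/-- One direction of the analysis of the extensions of a dominating set by one point. -/
theorem IsReplacement.isDominating_insert {I P : Type*} [DecidableEq P]
    {r : I → P → ℕ} {D : Finset P} (hD : IsDominating r D)
    {μ : I → P} (hμ : ∀ i, μ i ∈ D ∧ ∀ x ∈ D, r i (μ i) ≤ r i x)
    (hsurj : ∀ x ∈ D, ∃ i, μ i = x) {a b : I} (hab : a ≠ b) (hμab : μ a = μ b)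
    {x : P} (hx : IsReplacement r μ a x) :
    x ∉ D ∧ r a x ≤ r a (μ a) ∧ IsDominating r (insert x D) := by
  have hxD : x ∉ D := by
    intro h
    obtain ⟨i, rfl⟩ := hsurj x h
    by_cases hi : i = a
    · subst hi
      have := hx.1 b hab.symm
      rw [hμab] at this
      exact lt_irrefl _ this
    · exact lt_irrefl _ (hx.1 i hi)
  have hxa : r a x ≤ r a (μ a) := by
    obtain ⟨i, hi⟩ := hD x
    by_cases h : i = a
    · subst h; exact hi _ (hμ i).1
    · exact absurd (hi _ (hμ i).1) (not_le.2 (hx.1 i h))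
  refine ⟨hxD, hxa, fun y => ?_⟩
  by_cases hy : ∀ i, i ≠ a → r i (μ i) < r i y
  · refine ⟨a, fun z hz => ?_⟩
    rcases Finset.mem_insert.1 hz with rfl | hz
    · exact hx.2 y hy
    · exact (hx.2 y hy).trans (hxa.trans ((hμ a).2 z hz))
  · push Not at hy
    obtain ⟨i, hia, hi⟩ := hy
    refine ⟨i, fun z hz => ?_⟩
    rcases Finset.mem_insert.1 hz with rfl | hz
    · exact hi.trans (hx.1 i hia).le
    · exact hi.trans ((hμ i).2 z hz)

/-- The possible extensions of a dominating set of `|I| - 1` points to a dominating set of `|I|`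
points. -/
theorem IsDominating.exists_extension_data {I P : Type*} [Fintype I] [DecidableEq I]
    [DecidableEq P] {r : I → P → ℕ} (hr : ∀ i, Function.Injective (r i)) {D : Finset P}
    (hD : IsDominating r D) (hcard : D.card + 1 = Fintype.card I) (hne : D.Nonempty) :
    ∃ (μ : I → P) (a b : I), a ≠ b ∧ μ a = μ b ∧
      (∀ i, μ i ∈ D ∧ ∀ x ∈ D, r i (μ i) ≤ r i x) ∧
      (∀ x, IsReplacement r μ a x → ¬ IsReplacement r μ b x) ∧
      ∀ x, (x ∉ D ∧ IsDominating r (insert x D)) ↔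
        (IsReplacement r μ a x ∨ IsReplacement r μ b x) := by
  choose μ hμ using fun i => Finset.exists_min_image D (r i) hne
  have hsurj : ∀ x ∈ D, ∃ i, μ i = x := by
    intro x hx
    obtain ⟨i, hi⟩ := hD x
    exact ⟨i, hr i (le_antisymm ((hμ i).2 x hx) (hi _ (hμ i).1))⟩
  obtain ⟨a, -, b, -, hab, hμab⟩ : ∃ a ∈ Finset.univ, ∃ b ∈ Finset.univ, a ≠ b ∧ μ a = μ b :=
    Finset.exists_ne_map_eq_of_card_lt_of_maps_to (t := D)
      (by rw [Finset.card_univ]; omega) (fun i _ => (hμ i).1)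
  have inj : ∀ a b, a ≠ b → μ a = μ b → ∀ i j, i ≠ a → j ≠ a → μ i = μ j → i = j := by
    intro a b hab hμab i j hi hj hij
    have himg : D ⊆ (Finset.univ.erase a).image μ := by
      intro x hx
      obtain ⟨i, rfl⟩ := hsurj x hx
      by_cases h : i = a
      · exact Finset.mem_image.2 ⟨b, by simp [hab.symm], by rw [h, hμab]⟩
      · exact Finset.mem_image.2 ⟨i, by simp [h], rfl⟩
    have hc : ((Finset.univ.erase a).image μ).card = (Finset.univ.erase a).card := by
      refine le_antisymm Finset.card_image_le ?_
      refine le_trans ?_ (Finset.card_le_card himg)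
      rw [Finset.card_erase_of_mem (Finset.mem_univ _), Finset.card_univ]
      omega
    exact Finset.card_image_iff.1 hc (by simp [hi]) (by simp [hj]) hij
  have key : ∀ a b, a ≠ b → μ a = μ b → ∀ x, x ∉ D → IsDominating r (insert x D) →
      (∀ z ∈ D, r a x ≤ r a z) → IsReplacement r μ a x := by
    intro a b hab hμab x hxD hx hxa
    have hlt : ∀ i, i ≠ a → r i (μ i) < r i x := by
      intro i hi
      obtain ⟨j, hj⟩ := hx (μ i)
      have hjx := hj x (Finset.mem_insert_self _ _)
      have hμj : μ i = μ j :=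
        hr j (le_antisymm (hj _ (Finset.mem_insert_of_mem (hμ j).1)) ((hμ j).2 _ (hμ i).1))
      have hne : μ i ≠ x := fun h => hxD (h ▸ (hμ i).1)
      have hja : j ≠ a := by
        rintro rfl
        exact hne (hr j (le_antisymm hjx (hxa _ (hμ i).1)))
      obtain rfl := inj a b hab hμab i j hi hja hμj
      exact lt_of_le_of_ne hjx fun h => hne (hr _ h)
    refine ⟨hlt, fun y hy => ?_⟩
    obtain ⟨j, hj⟩ := hx y
    by_cases hja : j = a
    · subst hja; exact hj x (Finset.mem_insert_self _ _)
    · exact absurd (hj _ (Finset.mem_insert_of_mem (hμ j).1)) (not_le.2 (hy j hja))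
  refine ⟨μ, a, b, hab, hμab, hμ, fun x hxa hxb => ?_, fun x => ⟨fun ⟨hxD, hx⟩ => ?_, ?_⟩⟩
  · exact absurd (hxa.isDominating_insert hD hμ hsurj hab hμab).2.1 (not_le.2 (hxb.1 a hab))
  · obtain ⟨k, hk⟩ := hx x
    have hk' : ∀ z ∈ D, r k x ≤ r k z := fun z hz => hk z (Finset.mem_insert_of_mem hz)
    obtain ⟨j, hj⟩ := hx (μ k)
    have hμj : μ k = μ j :=
      hr j (le_antisymm (hj _ (Finset.mem_insert_of_mem (hμ j).1)) ((hμ j).2 _ (hμ k).1))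
    have hjk : k ≠ j := by
      rintro rfl
      have := hr k (le_antisymm (hk' _ (hμ k).1) (hj x (Finset.mem_insert_self _ _)))
      exact hxD (this ▸ (hμ k).1)
    by_cases hka : k = a
    · subst hka; exact Or.inl (key k b hab hμab x hxD hx hk')
    by_cases hkb : k = b
    · subst hkb; exact Or.inr (key k a hab.symm hμab.symm x hxD hx hk')
    by_cases hja : j = a
    · exact absurd (inj b a hab.symm hμab.symm k j hkb (hja ▸ hab) hμj) hjk
    · exact absurd (inj a b hab hμab k j hka hja hμj) hjk
  · rintro (h | h)
    · have := h.isDominating_insert hD hμ hsurj hab hμab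
      exact ⟨this.1, this.2.2⟩
    · have := h.isDominating_insert hD hμ hsurj hab.symm hμab.symm
      exact ⟨this.1, this.2.2⟩

theorem Finset.exists_eq_insert_of_subset_of_card {P : Type*} [DecidableEq P] {D S : Finset P}
    (h : D ⊆ S) (hc : D.card + 1 = S.card) : ∃ x, x ∉ D ∧ S = insert x D := by
  obtain ⟨x, hx, rfl⟩ := Finset.exists_eq_insert_iff.2 ⟨h, hc⟩
  exact ⟨x, hx, rfl⟩

theorem Finset.exists_eq_erase_of_subset_of_card {P : Type*} [DecidableEq P] {D S : Finset P}
    (h : D ⊆ S) (hc : D.card + 1 = S.card) : ∃ x ∈ S, D = S.erase x := by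
  obtain ⟨x, hx, rfl⟩ := Finset.exists_eq_insert_of_subset_of_card h hc
  exact ⟨x, Finset.mem_insert_self _ _, (Finset.erase_insert hx).symm⟩

/-- A finset whose image misses something contains an even number of subsets obtained by removing
one point with image exactly the complement of `k`. -/
theorem even_card_subsets_image_eq_erase {I P : Type*} [Fintype I] [DecidableEq I]
    [DecidableEq P] {S : Finset P} (hS : S.card = Fintype.card I)
    (c : P → I) (hc : S.image c ≠ Finset.univ) (k : I) (𝓓 : Finset (Finset P))
    (h𝓓 : ∀ D, D ⊆ S → (D ∈ 𝓓 ↔ D.card + 1 = Fintype.card I ∧ D.image c = Finset.univ.erase k)) :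
    Even (𝓓.filter (· ⊆ S)).card := by
  rcases (𝓓.filter (· ⊆ S)).eq_empty_or_nonempty with h | ⟨D, hD⟩
  · simp [h]
  obtain ⟨hD𝓓, hDS⟩ := Finset.mem_filter.1 hD
  obtain ⟨hDc, hDim⟩ := (h𝓓 D hDS).1 hD𝓓
  obtain ⟨x, hxD, rfl⟩ := Finset.exists_eq_insert_of_subset_of_card hDS (hDc.trans hS.symm)
  have hinj : Set.InjOn c D := by
    apply Finset.card_image_iff.1
    rw [hDim, Finset.card_erase_of_mem (Finset.mem_univ _), Finset.card_univ]
    omega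
  have hxk : c x ≠ k := by
    intro h
    apply hc
    rw [Finset.image_insert, hDim, h, Finset.insert_erase (Finset.mem_univ _)]
  obtain ⟨y, hyD, hyx⟩ : ∃ y ∈ D, c y = c x := by
    rw [← Finset.mem_image, hDim]; simp [hxk]
  have hxy : x ≠ y := fun h => hxD (h ▸ hyD)
  have heq : 𝓓.filter (· ⊆ insert x D) = {D, (insert x D).erase y} := by
    ext E
    simp only [Finset.mem_filter, Finset.mem_insert, Finset.mem_singleton]
    constructor
    · rintro ⟨hE, hES⟩
      obtain ⟨hEc, hEim⟩ := (h𝓓 E hES).1 hE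
      obtain ⟨z, hz, rfl⟩ := Finset.exists_eq_erase_of_subset_of_card hES (hEc.trans hS.symm)
      by_cases hzx : z = x
      · subst hzx; left; exact Finset.erase_insert hxD
      right
      congr 1
      have hzD : z ∈ D := (Finset.mem_insert.1 hz).resolve_left hzx
      have hcz : c z ∈ ((insert x D).erase z).image c := by
        rw [hEim, ← hDim]; exact Finset.mem_image_of_mem _ hzD
      obtain ⟨w, hw, hwz⟩ := Finset.mem_image.1 hcz
      obtain ⟨hwne, hw⟩ := Finset.mem_erase.1 hw
      rcases Finset.mem_insert.1 hw with rfl | hw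
      · exact hinj hzD hyD (hwz.symm.trans hyx.symm)
      · exact absurd (hinj hw hzD hwz) hwne
    · rintro (rfl | rfl)
      · exact ⟨hD𝓓, hDS⟩
      · have hsub : (insert x D).erase y ⊆ insert x D := Finset.erase_subset _ _
        refine ⟨(h𝓓 _ hsub).2 ⟨?_, ?_⟩, hsub⟩
        · rw [Finset.card_erase_of_mem (Finset.mem_insert_of_mem hyD),
            Finset.card_insert_of_notMem hxD]
          omega
        · rw [← hDim]
          ext i
          simp only [Finset.mem_image, Finset.mem_erase, Finset.mem_insert]
          constructor
          · rintro ⟨z, ⟨hzy, rfl | hz⟩, rfl⟩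
            · exact ⟨y, hyD, hyx⟩
            · exact ⟨z, hz, rfl⟩
          · rintro ⟨z, hz, rfl⟩
            by_cases hzy : z = y
            · subst hzy; exact ⟨x, ⟨hxy, Or.inl rfl⟩, hyx.symm⟩
            · exact ⟨z, ⟨hzy, Or.inr hz⟩, rfl⟩
  rw [heq, Finset.card_pair]
  · exact even_two
  · intro h
    have := h ▸ hyD
    simp at this

/-- **Scarf's combinatorial lemma.** For every colouring of the points there is a dominating
set using all colours exactly once. The points of the summand `I` play the role of slack
points. -/
theorem exists_isDominating_image_eq_univ {I X : Type*} [Fintype I] [DecidableEq I] [Nontrivial I]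
    [Fintype X] [DecidableEq X] [Nonempty X] {r : I → X ⊕ I → ℕ}
    (hr : ∀ i, Function.Injective (r i))
    (hlow : ∀ i p, p ≠ Sum.inr i → r i (Sum.inr i) < r i p)
    (hhigh : ∀ i j x, j ≠ i → r i (Sum.inl x) < r i (Sum.inr j))
    (c : X ⊕ I → I) (hc : ∀ j, c (Sum.inr j) = j) :
    ∃ S : Finset (X ⊕ I), S.card = Fintype.card I ∧ IsDominating r S ∧
      S.image c = Finset.univ := by
  classical
  obtain ⟨k⟩ : Nonempty I := inferInstance
  by_contra! hno
  set 𝓡 : Finset (Finset (X ⊕ I)) :=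
    Finset.univ.filter fun S => S.card = Fintype.card I ∧ IsDominating r S with h𝓡
  set 𝓓 : Finset (Finset (X ⊕ I)) := Finset.univ.filter fun D =>
    D.card + 1 = Fintype.card I ∧ IsDominating r D ∧ D.image c = Finset.univ.erase k with h𝓓
  have hrooms : Even (∑ S ∈ 𝓡, (𝓓.filter (· ⊆ S)).card) := by
    refine Finset.even_sum _ fun S hS => ?_
    obtain ⟨hSc, hSd⟩ := (Finset.mem_filter.1 hS).2
    refine even_card_subsets_image_eq_erase hSc c (hno S hSc hSd) k _ fun D hD => ?_
    simp [h𝓓, hSd.mono hD]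
  have hext : ∀ D ∈ 𝓓, ∀ S, S ∈ 𝓡.filter (D ⊆ ·) ↔
      ∃ x, (x ∉ D ∧ IsDominating r (insert x D)) ∧ S = insert x D := by
    intro D hD S
    obtain ⟨hDc, -, -⟩ := (Finset.mem_filter.1 hD).2
    simp only [h𝓡, Finset.mem_filter, Finset.mem_univ, true_and]
    constructor
    · rintro ⟨⟨hSc, hSd⟩, hDS⟩
      obtain ⟨x, hx, rfl⟩ := Finset.exists_eq_insert_of_subset_of_card hDS (hDc.trans hSc.symm)
      exact ⟨x, ⟨hx, hSd⟩, rfl⟩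
    · rintro ⟨x, ⟨hx, hxd⟩, rfl⟩
      exact ⟨⟨by rw [Finset.card_insert_of_notMem hx, hDc], hxd⟩, Finset.subset_insert _ _⟩
  have hcardI : 1 < Fintype.card I := Fintype.one_lt_card
  have hdne : ∀ D ∈ 𝓓, D.Nonempty := by
    intro D hD
    obtain ⟨hDc, -, -⟩ := (Finset.mem_filter.1 hD).2
    rw [← Finset.card_pos]; omega
  set D₀ : Finset (X ⊕ I) := (Finset.univ.erase k).image Sum.inr with hD₀
  have hD₀mem : D₀ ∈ 𝓓 := by
    refine Finset.mem_filter.2 ⟨Finset.mem_univ _, ?_, ?_, ?_⟩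
    · rw [Finset.card_image_of_injective _ Sum.inr_injective,
        Finset.card_erase_of_mem (Finset.mem_univ _), Finset.card_univ]
      omega
    · rintro (x | j)
      · refine ⟨k, fun p hp => ?_⟩
        obtain ⟨l, hl, rfl⟩ := Finset.mem_image.1 hp
        exact (hhigh k l x (Finset.mem_erase.1 hl).1).le
      · refine ⟨j, fun p _ => ?_⟩
        by_cases hp : p = Sum.inr j
        · rw [hp]
        · exact (hlow j p hp).le
    · rw [hD₀, Finset.image_image]
      rw [show c ∘ Sum.inr = id from funext hc, Finset.image_id]
  have hother : ∀ D ∈ 𝓓, D ≠ D₀ → (𝓡.filter (D ⊆ ·)).card = 2 := by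
    intro D hD hne
    obtain ⟨hDc, hDd, hDim⟩ := (Finset.mem_filter.1 hD).2
    obtain ⟨μ, a, b, hab, hμab, hμ, hdisj, hiff⟩ :=
      hDd.exists_extension_data hr hDc (hdne D hD)
    obtain ⟨x₀, hx₀⟩ : ∃ x, Sum.inl x ∈ D := by
      by_contra! hcon
      apply hne
      apply Finset.eq_of_subset_of_card_le
      · rintro (x | j) hp
        · exact absurd hp (hcon x)
        · have := Finset.mem_image_of_mem c hp
          rw [hDim, hc] at this
          exact Finset.mem_image_of_mem _ this
      · have := (Finset.mem_filter.1 hD₀mem).2.1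
        omega
    have hex : ∀ a, ∃ x, IsReplacement r μ a x := fun a =>
      exists_isReplacement (y := Sum.inr a) fun i hi =>
        ((hμ i).2 _ hx₀).trans_lt (hhigh i a x₀ hi.symm)
    obtain ⟨x, hx⟩ := hex a
    obtain ⟨y, hy⟩ := hex b
    have hxD := ((hiff x).2 (Or.inl hx)).1
    have hyD := ((hiff y).2 (Or.inr hy)).1
    have heq : 𝓡.filter (D ⊆ ·) = {insert x D, insert y D} := by
      ext S
      rw [hext D hD]
      simp only [hiff, Finset.mem_insert, Finset.mem_singleton]
      constructor
      · rintro ⟨z, hz | hz, rfl⟩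
        · left; rw [hz.eq hr hx]
        · right; rw [hz.eq hr hy]
      · rintro (rfl | rfl)
        exacts [⟨x, Or.inl hx, rfl⟩, ⟨y, Or.inr hy, rfl⟩]
    rw [heq, Finset.card_pair]
    intro h
    have hxm : x ∈ insert y D := h ▸ Finset.mem_insert_self x D
    rcases Finset.mem_insert.1 hxm with rfl | hxm
    · exact hdisj _ hx hy
    · exact hxD hxm
  have hD₀one : (𝓡.filter (D₀ ⊆ ·)).card = 1 := by
    obtain ⟨hDc, hDd, hDim⟩ := (Finset.mem_filter.1 hD₀mem).2
    obtain ⟨μ, a, b, hab, hμab, hμ, hdisj, hiff⟩ :=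
      hDd.exists_extension_data hr hDc (hdne D₀ hD₀mem)
    have hμr : ∀ i, i ≠ k → μ i = Sum.inr i := by
      intro i hi
      by_contra hne
      exact absurd ((hμ i).2 (Sum.inr i) (by simp [hD₀, hi])) (not_le.2 (hlow i _ hne))
    have key : ∀ b, b ≠ k → μ k = μ b → (∃ x, IsReplacement r μ k x) ∧
        ∀ x, ¬ IsReplacement r μ b x := by
      intro b hb hμb
      obtain ⟨x₀⟩ : Nonempty X := inferInstance
      refine ⟨exists_isReplacement (y := Sum.inl x₀) fun i hi => ?_, fun x hx => ?_⟩
      · rw [hμr i hi]; exact hlow i _ (by simp)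
      · have h1 := hx.1 k hb.symm
        rw [hμb, hμr b hb] at h1
        rcases x with x | j
        · exact absurd h1 (not_lt.2 (hhigh k b x hb).le)
        · by_cases hjb : j = b
          · subst hjb; exact lt_irrefl _ h1
          · have h2 := hx.1 j hjb
            by_cases hm : μ j = Sum.inr j
            · rw [hm] at h2; exact lt_irrefl _ h2
            · exact absurd h2 (not_lt.2 (hlow j _ hm).le)
    obtain ⟨x, hx⟩ : ∃ x, ∀ z, (IsReplacement r μ a z ∨ IsReplacement r μ b z) ↔ z = x := by
      by_cases hak : a = k
      · subst hak
        obtain ⟨⟨x, hx⟩, h2⟩ := key b hab.symm hμab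
        exact ⟨x, fun z => ⟨fun h => (h.resolve_right (h2 z)).eq hr hx,
          fun h => Or.inl (h ▸ hx)⟩⟩
      · by_cases hbk : b = k
        · subst hbk
          obtain ⟨⟨x, hx⟩, h2⟩ := key a hab hμab.symm
          exact ⟨x, fun z => ⟨fun h => (h.resolve_left (h2 z)).eq hr hx,
            fun h => Or.inr (h ▸ hx)⟩⟩
        · rw [hμr a hak, hμr b hbk] at hμab
          exact absurd (Sum.inr_injective hμab) hab
    rw [Finset.card_eq_one]
    refine ⟨insert x D₀, ?_⟩
    ext S
    rw [hext D₀ hD₀mem]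
    simp only [hiff, hx, Finset.mem_singleton, exists_eq_left]
  have hdoors : Odd (∑ D ∈ 𝓓, (𝓡.filter (D ⊆ ·)).card) := by
    rw [← Finset.add_sum_erase _ _ hD₀mem, hD₀one, add_comm]
    refine Even.add_one (Finset.even_sum _ fun D hD => ?_)
    obtain ⟨hne, hD⟩ := Finset.mem_erase.1 hD
    rw [hother D hD hne]
    exact even_two
  have hcount := Finset.sum_card_bipartiteAbove_eq_sum_card_bipartiteBelow
    (s := 𝓓) (t := 𝓡) (fun D S => D ⊆ S)
  simp only [Finset.bipartiteAbove, Finset.bipartiteBelow] at hcount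
  rw [hcount] at hdoors
  exact (Nat.not_even_iff_odd.2 hdoors) hrooms

theorem exists_injective_refinement {P : Type*} [Fintype P] (u : P → ℕ) :
    ∃ r : P → ℕ, Function.Injective r ∧ ∀ p q, r p ≤ r q → u p ≤ u q := by
  let e := Fintype.equivFin P
  have hlt : ∀ p q, u p < u q →
      u p * Fintype.card P + (e p : ℕ) < u q * Fintype.card P + (e q : ℕ) := by
    intro p q h
    have h1 : (u p + 1) * Fintype.card P ≤ u q * Fintype.card P := Nat.mul_le_mul_right _ h
    have h2 := (e p).2
    rw [add_mul] at h1
    omega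
  refine ⟨fun p => u p * Fintype.card P + (e p : ℕ), fun p q h => ?_, fun p q h => ?_⟩
  · have hpq : u p = u q := by
      rcases lt_trichotomy (u p) (u q) with h' | h' | h'
      · exact absurd h (hlt p q h').ne
      · exact h'
      · exact absurd h (hlt q p h').ne'
    have : (e p : ℕ) = e q := by
      simp only [hpq] at h
      omega
    exact e.injective (Fin.ext this)
  · by_contra h'
    exact absurd h (not_le.2 (hlt q p (not_le.1 h')))

/-- A combinatorial form of the KKM lemma on the grid of points of a simplex with integer
coordinates of sum `K`. -/
theorem exists_grid_point {I : Type*} [Fintype I] [DecidableEq I] [Nontrivial I] (K : ℕ)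
    (c : (I → ℕ) → I) :
    ∃ z : I → ℕ, ∑ i, z i = K ∧ ∀ i, z i ≤ Fintype.card I ∨
      ∃ x : I → ℕ, ∑ i, x i = K ∧ c x = i ∧
        ∀ l, x l ≤ z l + Fintype.card I ∧ z l ≤ x l + Fintype.card I := by
  obtain ⟨i₀⟩ : Nonempty I := inferInstance
  let X := ↥(Finset.piAntidiag (Finset.univ : Finset I) K)
  have hX : ∀ x : X, ∑ i, x.1 i = K := fun x => (Finset.mem_piAntidiag.1 x.2).1
  have mkX : ∀ x : I → ℕ, ∑ i, x i = K → ∃ y : X, y.1 = x := fun x hx =>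
    ⟨⟨x, Finset.mem_piAntidiag.2 ⟨hx, by simp⟩⟩, rfl⟩
  obtain ⟨x₀, -⟩ := mkX (Pi.single i₀ K) (by simp)
  have : Nonempty X := ⟨x₀⟩
  have hsumK : ∀ (x : X) (T : Finset I), ∑ i ∈ T, x.1 i ≤ K := fun x T =>
    (Finset.sum_le_univ_sum_of_nonneg fun _ => Nat.zero_le _).trans_eq (hX x)
  have hle : ∀ (x : X) i, x.1 i ≤ K := fun x i => by simpa using hsumK x {i}
  let u : I → X ⊕ I → ℕ := fun i => Sum.elim (fun x => x.1 i + 1) fun j => if j = i then 0 else K + 2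
  choose r hr hru using fun i => exists_injective_refinement (u i)
  have hrlt : ∀ i p q, u i p < u i q → r i p < r i q := fun i p q h => by
    by_contra h'
    exact absurd (hru i q p (not_lt.1 h')) (not_le.2 h)
  have hlow : ∀ i p, p ≠ Sum.inr i → r i (Sum.inr i) < r i p := by
    rintro i (x | j) hp
    · apply hrlt; simp [u]
    · have hji : j ≠ i := fun h => hp (h ▸ rfl)
      apply hrlt; simp [u, hji]
  have hhigh : ∀ i j (x : X), j ≠ i → r i (Sum.inl x) < r i (Sum.inr j) := by
    intro i j x hj
    have := hle x i
    apply hrlt; simp only [u, Sum.elim_inl, Sum.elim_inr, if_neg hj]; omega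
  obtain ⟨S, hSc, hSd, hSim⟩ := exists_isDominating_image_eq_univ hr hlow hhigh
    (Sum.elim (fun x => c x.1) id) (fun _ => rfl)
  set C : Finset I := Finset.univ.filter fun i => Sum.inr i ∉ S with hC
  have hdom : ∀ y : X, ∃ i ∈ C, ∀ x : X, Sum.inl x ∈ S → y.1 i ≤ x.1 i := by
    intro y
    obtain ⟨i, hi⟩ := hSd (Sum.inl y)
    refine ⟨i, ?_, fun x hx => ?_⟩
    · simp only [hC, Finset.mem_filter, Finset.mem_univ, true_and]
      intro h
      exact absurd (hi _ h) (not_le.2 (hlow i _ (by simp)))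
    · have := hru i _ _ (hi _ hx)
      simpa [u] using this
  have hcol : ∀ i ∈ C, ∃ x : X, Sum.inl x ∈ S ∧ c x.1 = i := by
    intro i hi
    have hi' : i ∈ S.image (Sum.elim (fun x : X => c x.1) id) := by rw [hSim]; exact Finset.mem_univ i
    obtain ⟨x | j, hp, hpi⟩ := Finset.mem_image.1 hi'
    · exact ⟨x, hp, hpi⟩
    · have : j = i := hpi
      subst this
      exact absurd hp (Finset.mem_filter.1 hi).2
  obtain ⟨z, hz⟩ : ∃ z : X, Sum.inl z ∈ S := by
    obtain ⟨i, hi, -⟩ := hdom x₀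
    obtain ⟨x, hx, -⟩ := hcol i hi
    exact ⟨x, hx⟩
  have hmin : ∀ i, ∃ w : X, Sum.inl w ∈ S ∧ ∀ x : X, Sum.inl x ∈ S → w.1 i ≤ x.1 i := by
    intro i
    obtain ⟨w, hw, hwmin⟩ := Set.exists_min_image {x : X | Sum.inl x ∈ S} (fun x => x.1 i)
      (Set.toFinite _) ⟨z, hz⟩
    exact ⟨w, hw, hwmin⟩
  choose w hw hwmin using hmin
  have hsum : K < ∑ i ∈ C, ((w i).1 i + 1) := by
    by_contra! hcon
    obtain ⟨y, hy⟩ := mkX (fun i => (if i ∈ C then (w i).1 i + 1 else 0) +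
      if i = i₀ then K - ∑ i ∈ C, ((w i).1 i + 1) else 0) (by
        rw [Finset.sum_add_distrib, Finset.sum_ite_mem]
        simp only [Finset.univ_inter, Finset.sum_ite_eq', Finset.mem_univ, if_true]
        omega)
    obtain ⟨i, hi, hyi⟩ := hdom y
    have := hyi _ (hw i)
    rw [hy] at this
    simp only [hi, if_true] at this
    omega
  have hCcard : C.card ≤ Fintype.card I := Finset.card_le_univ _
  rw [Finset.sum_add_distrib, Finset.sum_const, smul_eq_mul, mul_one] at hsum
  have hsumle : ∀ T : Finset I, ∀ x : X, Sum.inl x ∈ S → ∑ i ∈ T, (w i).1 i ≤ ∑ i ∈ T, x.1 i :=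
    fun T x hx => Finset.sum_le_sum fun i _ => hwmin i x hx
  have hnotC : ∀ x : X, Sum.inl x ∈ S → ∀ l ∉ C, x.1 l ≤ Fintype.card I := by
    intro x hx l hl
    have h1 := hsumle C x hx
    have h2 := hsumK x (insert l C)
    rw [Finset.sum_insert hl] at h2
    omega
  have hinC : ∀ x : X, Sum.inl x ∈ S → ∀ l ∈ C, x.1 l ≤ (w l).1 l + Fintype.card I := by
    intro x hx l hl
    have h1 := hsumle (C.erase l) x hx
    have h2 := hsumK x C
    rw [← Finset.add_sum_erase _ _ hl] at h2 hsum
    omega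
  have hclose : ∀ x y : X, Sum.inl x ∈ S → Sum.inl y ∈ S → ∀ l,
      x.1 l ≤ y.1 l + Fintype.card I := by
    intro x y hx hy l
    by_cases hl : l ∈ C
    · have := hinC x hx l hl
      have := hwmin l y hy
      omega
    · have := hnotC x hx l hl
      omega
  refine ⟨z.1, hX z, fun i => ?_⟩
  by_cases hi : i ∈ C
  · obtain ⟨x, hx, hxi⟩ := hcol i hi
    exact Or.inr ⟨x.1, hX x, hxi, fun l => ⟨hclose x z hx hz l, hclose z x hz hx l⟩⟩
  · exact Or.inl (hnotC z hz i hi)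

/-- **Dual KKM lemma.** If closed sets `A i` cover the standard simplex and each `A i` contains
the facet `x i = 0`, then they have a common point in the simplex. -/
theorem exists_mem_stdSimplex_forall_mem {I : Type*} [Fintype I] [Nontrivial I]
    {A : I → Set (I → ℝ)} (hA : ∀ i, IsClosed (A i))
    (hcov : ∀ x ∈ stdSimplex ℝ I, ∃ i, x ∈ A i)
    (hface : ∀ x ∈ stdSimplex ℝ I, ∀ i, x i = 0 → x ∈ A i) :
    ∃ x ∈ stdSimplex ℝ I, ∀ i, x ∈ A i := by
  classical
  have hne : ∀ i, (A i).Nonempty := by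
    intro i
    obtain ⟨j, hj⟩ := exists_ne i
    exact ⟨Pi.single j 1, hface _ (single_mem_stdSimplex ℝ j) i (by simp [hj.symm])⟩
  let f : (I → ℝ) → ℝ := fun z => ∑ i, min (z i) (Metric.infDist z (A i))
  have hf : Continuous f := by fun_prop
  obtain ⟨i₀⟩ : Nonempty I := inferInstance
  obtain ⟨z, hz, hzmin⟩ := (isCompact_stdSimplex ℝ I).exists_isMinOn
    ⟨Pi.single i₀ 1, single_mem_stdSimplex ℝ i₀⟩ hf.continuousOn
  have hterm : ∀ i, 0 ≤ min (z i) (Metric.infDist z (A i)) := fun i =>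
    le_min (hz.1 i) Metric.infDist_nonneg
  set m : ℝ := (Fintype.card I : ℝ) with hm
  have hbound : ∀ K : ℕ, f z ≤ m * (m / ((K : ℝ) + 1)) := by
    intro K
    have hK : (0 : ℝ) < (K : ℝ) + 1 := by positivity
    let sc : (I → ℕ) → I → ℝ := fun x i => (x i : ℝ) / ((K : ℝ) + 1)
    have hsc : ∀ x : I → ℕ, ∑ i, x i = K + 1 → sc x ∈ stdSimplex ℝ I := by
      intro x hx
      refine ⟨fun i => by positivity, ?_⟩
      rw [← Finset.sum_div, ← Nat.cast_sum, hx]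
      push_cast
      exact div_self hK.ne'
    have hc : ∀ x : I → ℕ, ∃ i, ∑ i, x i = K + 1 → sc x ∈ A i := by
      intro x
      by_cases hx : ∑ i, x i = K + 1
      · exact (hcov _ (hsc x hx)).imp fun _ h _ => h
      · exact ⟨i₀, fun h => absurd h hx⟩
    choose c hc using hc
    obtain ⟨y, hy, hyi⟩ := exists_grid_point (K + 1) c
    refine (hzmin (hsc y hy)).trans ?_
    have : ∀ i ∈ Finset.univ, min (sc y i) (Metric.infDist (sc y) (A i)) ≤ m / ((K : ℝ) + 1) := by
      intro i _
      rcases hyi i with h | ⟨x, hx, rfl, hxl⟩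
      · refine (min_le_left _ _).trans ?_
        exact div_le_div_of_nonneg_right (by rw [hm]; exact_mod_cast h) hK.le
      · refine (min_le_right _ _).trans
          ((Metric.infDist_le_dist_of_mem (hc x hx)).trans ?_)
        rw [dist_pi_le_iff (by positivity)]
        intro l
        rw [Real.dist_eq, ← sub_div, abs_div, abs_of_pos hK]
        refine div_le_div_of_nonneg_right ?_ hK.le
        have h1 : (x l : ℝ) ≤ y l + m := by rw [hm]; exact_mod_cast (hxl l).1
        have h2 : (y l : ℝ) ≤ x l + m := by rw [hm]; exact_mod_cast (hxl l).2
        rw [abs_le]; constructor <;> linarith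
    refine (Finset.sum_le_sum this).trans ?_
    simp [hm]
  have hlim : Filter.Tendsto (fun K : ℕ => m * (m / ((K : ℝ) + 1))) Filter.atTop (nhds 0) := by
    have := (tendsto_one_div_add_atTop_nhds_zero_nat (𝕜 := ℝ)).const_mul (m * m)
    simp only [mul_zero] at this
    refine this.congr fun K => by ring
  have hf0 : f z ≤ 0 := ge_of_tendsto' hlim hbound
  refine ⟨z, hz, fun i => ?_⟩
  have hi : min (z i) (Metric.infDist z (A i)) ≤ 0 :=
    (Finset.single_le_sum (f := fun i => min (z i) (Metric.infDist z (A i)))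
      (fun i _ => hterm i) (Finset.mem_univ i)).trans hf0
  rcases min_le_iff.1 hi with h | h
  · exact hface z hz i (le_antisymm h (hz.1 i))
  · exact ((hA i).mem_iff_infDist_zero (hne i)).2 (le_antisymm h Metric.infDist_nonneg)

theorem exists_first_zero {ι : Type*} [Finite ι] {a b : ι → ℝ} (ha : ∀ k, 0 ≤ a k)
    (hb : ∃ k, b k < 0) :
    ∃ t : ℝ, 0 ≤ t ∧ (∀ k, 0 ≤ a k + t * b k) ∧ ∃ k, b k < 0 ∧ a k + t * b k = 0 := by
  obtain ⟨k, hk, hmin⟩ := Set.exists_min_image {k | b k < 0} (fun k => a k / (-b k))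
    (Set.toFinite _) hb
  have hk' : 0 < -b k := neg_pos.2 hk
  have ht : 0 ≤ a k / (-b k) := div_nonneg (ha k) hk'.le
  refine ⟨a k / (-b k), ht, fun l => ?_, k, hk, ?_⟩
  · rcases lt_or_ge (b l) 0 with hl | hl
    · have h := hmin l hl
      rw [le_div_iff₀ (neg_pos.2 hl)] at h
      linarith
    · exact add_nonneg (ha l) (mul_nonneg ht hl)
  · have := div_mul_cancel₀ (a k) hk'.ne'
    linarith

/-- The total weight of the edges of a `J`-partite hypergraph through the vertex `p.2` of the
part `p.1`, where the edge `e` has the vertex `φ e i` in the part `i`. -/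
def vertexWeight {E J V : Type*} [Fintype E] [DecidableEq V] (φ : E → J → V) (w : E → ℝ)
    (p : J × V) : ℝ :=
  ∑ e, if φ e p.1 = p.2 then w e else 0

theorem sum_vertexWeight {E J V : Type*} [Fintype E] [Fintype V] [DecidableEq V] (φ : E → J → V)
    (w : E → ℝ) (i : J) : ∑ v, vertexWeight φ w (i, v) = ∑ e, w e := by
  unfold vertexWeight
  rw [Finset.sum_comm]
  simp

theorem vertexWeight_add_mul {E J V : Type*} [Fintype E] [DecidableEq V] (φ : E → J → V)
    (w z : E → ℝ) (t : ℝ) (p : J × V) :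
    vertexWeight φ (fun e => w e + t * z e) p =
      vertexWeight φ w p + t * vertexWeight φ z p := by
  unfold vertexWeight
  rw [Finset.mul_sum, ← Finset.sum_add_distrib]
  exact Finset.sum_congr rfl fun e _ => by split_ifs <;> simp

theorem vertexWeight_const_mul {E J V : Type*} [Fintype E] [DecidableEq V] (φ : E → J → V)
    (z : E → ℝ) (t : ℝ) (p : J × V) :
    vertexWeight φ (fun e => t * z e) p = t * vertexWeight φ z p := by
  simp [vertexWeight, Finset.mul_sum]

/-- The set of edges meeting a heavy edge has small total weight. -/
theorem sum_meeting_le {E J V : Type*} [Fintype E] [Fintype J] [Nontrivial J]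
    [DecidableEq V] {φ : E → J → V} {w : E → ℝ} (hw : ∀ e, 0 ≤ w e)
    (hφ : ∀ p, vertexWeight φ w p ≤ 1) (e : E)
    (he : 1 ≤ ((Fintype.card J : ℝ) - 1) * w e) :
    (∑ f, if ∃ i, φ f i = φ e i then w f else 0) ≤ (Fintype.card J : ℝ) - 1 := by
  classical
  obtain ⟨i₀⟩ : Nonempty J := inferInstance
  have hsplit : ∀ P : E → Prop, [DecidablePred P] → P e →
      (∑ f, if P f then w f else 0) = w e + ∑ f ∈ Finset.univ.erase e, if P f then w f else 0 := by
    intro P _ hP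
    rw [← Finset.add_sum_erase _ _ (Finset.mem_univ e), if_pos hP]
  have h1 : (∑ f ∈ Finset.univ.erase e, if ∃ i, φ f i = φ e i then w f else 0) ≤
      ∑ i, ∑ f ∈ Finset.univ.erase e, if φ f i = φ e i then w f else 0 := by
    rw [Finset.sum_comm]
    refine Finset.sum_le_sum fun f _ => ?_
    have hnn : ∀ i ∈ Finset.univ, 0 ≤ if φ f i = φ e i then w f else 0 := fun i _ => by
      split_ifs
      exacts [hw f, le_rfl]
    split_ifs with h
    · obtain ⟨i, hi⟩ := h
      refine le_trans ?_ (Finset.single_le_sum hnn (Finset.mem_univ i))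
      simp [hi]
    · exact Finset.sum_nonneg hnn
  have h2 : ∀ i ∈ Finset.univ, (∑ f ∈ Finset.univ.erase e, if φ f i = φ e i then w f else 0) ≤
      1 - w e := by
    intro i _
    have := hφ (i, φ e i)
    unfold vertexWeight at this
    rw [hsplit (fun f => φ f i = φ e i) rfl] at this
    linarith
  have h3 := Finset.sum_le_sum h2
  rw [Finset.sum_const, Finset.card_univ, nsmul_eq_mul] at h3
  rw [hsplit _ ⟨i₀, rfl⟩]
  linarith

/-- In a fractional matching of a multipartite hypergraph, either some edge is heavy or the
weights can be perturbed without changing the weights of the saturated vertices. -/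
theorem exists_heavy_or_exists_direction {E J V : Type*} [Fintype E] [Fintype J] [Nontrivial J]
    [Fintype V] [DecidableEq V] {φ : E → J → V} {w : E → ℝ} (hne : w ≠ 0) :
    (∃ e, 1 ≤ ((Fintype.card J : ℝ) - 1) * w e) ∨
      ∃ z : E → ℝ, z ≠ 0 ∧ (∀ e, w e = 0 → z e = 0) ∧
        ∀ p, vertexWeight φ w p = 1 → vertexWeight φ z p = 0 := by
  classical
  by_contra! hcon
  obtain ⟨hheavy, hdir⟩ := hcon
  let L : (E → ℝ) →ₗ[ℝ] ({p // vertexWeight φ w p = 1} ⊕ {e // w e = 0} → ℝ) :=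
    { toFun := fun z => Sum.elim (fun p => vertexWeight φ z p.1) fun e => z e.1
      map_add' := by
        intro x y
        ext (p | e)
        · have := vertexWeight_add_mul φ x y 1 p.1
          simp only [one_mul] at this
          exact this
        · rfl
      map_smul' := by
        intro t x
        ext (p | e)
        · exact vertexWeight_const_mul φ x t p.1
        · rfl }
  have hLinj : Function.Injective L := by
    rw [← LinearMap.ker_eq_bot, LinearMap.ker_eq_bot']
    intro z hz
    by_contra hz0
    obtain ⟨p, hp, hpz⟩ := hdir z hz0 fun e he => congrFun hz (Sum.inr ⟨e, he⟩)
    exact hpz (congrFun hz (Sum.inl ⟨p, hp⟩))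
  have hdim := LinearMap.finrank_le_finrank_of_injective hLinj
  simp only [Module.finrank_fintype_fun_eq_card, Fintype.card_sum] at hdim
  set Sat : Finset (J × V) := Finset.univ.filter fun p => vertexWeight φ w p = 1 with hSat
  set Z : Finset E := Finset.univ.filter fun e => w e = 0 with hZ
  set S : Finset E := Finset.univ.filter fun e => ¬ w e = 0 with hS
  have hZS : Z.card + S.card = Fintype.card E :=
    Finset.card_filter_add_card_filter_not (s := Finset.univ) (fun e => w e = 0)
  have hcSat : Fintype.card {p // vertexWeight φ w p = 1} = Sat.card := Fintype.card_subtype _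
  have hcZ : Fintype.card {e // w e = 0} = Z.card := Fintype.card_subtype _
  let deg : J × V → ℕ := fun p => (S.filter fun e => φ e p.1 = p.2).card
  have hdeg : ∑ p, deg p = Fintype.card J * S.card := by
    rw [Fintype.sum_prod_type, ← smul_eq_mul, ← Finset.card_univ, ← Finset.sum_const]
    exact Finset.sum_congr rfl fun i _ =>
      (Finset.card_eq_sum_card_fiberwise (f := fun e => φ e i) (t := Finset.univ)
        fun _ _ => Finset.mem_coe.2 (Finset.mem_univ _)).symm
  have hJ : 1 < Fintype.card J := Fintype.one_lt_card
  have hJ' : (0 : ℝ) < (Fintype.card J : ℝ) - 1 := by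
    have : (1 : ℝ) < Fintype.card J := by exact_mod_cast hJ
    linarith
  have hdegSat : ∀ p ∈ Sat, Fintype.card J ≤ deg p := by
    intro p hp
    have hp1 : vertexWeight φ w p = 1 := (Finset.mem_filter.1 hp).2
    have hsum : ∑ e ∈ S.filter fun e => φ e p.1 = p.2, w e = 1 := by
      rw [← hp1, hS, Finset.filter_filter, Finset.sum_filter]
      unfold vertexWeight
      refine Finset.sum_congr rfl fun e _ => ?_
      by_cases h : w e = 0 <;> simp [h]
    by_contra! hlt
    have hne' : (S.filter fun e => φ e p.1 = p.2).Nonempty := by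
      by_contra h
      rw [Finset.not_nonempty_iff_eq_empty] at h
      rw [h, Finset.sum_empty] at hsum
      exact zero_ne_one hsum
    have hlt' : ∑ e ∈ S.filter (fun e => φ e p.1 = p.2), ((Fintype.card J : ℝ) - 1) * w e <
        ∑ e ∈ S.filter (fun e => φ e p.1 = p.2), 1 :=
      Finset.sum_lt_sum_of_nonempty hne' fun e _ => hheavy e
    rw [← Finset.mul_sum, hsum, Finset.sum_const, nsmul_eq_mul, mul_one, mul_one] at hlt'
    have : ((deg p : ℝ)) + 1 ≤ Fintype.card J := by exact_mod_cast hlt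
    change _ < (deg p : ℝ) at hlt'
    linarith
  have hsplit := Finset.sum_filter_add_sum_filter_not Finset.univ
    (fun p => vertexWeight φ w p = 1) deg
  rw [← hSat, hdeg] at hsplit
  have hSatsum : Sat.card * Fintype.card J ≤ ∑ p ∈ Sat, deg p := by
    simpa using Finset.card_nsmul_le_sum Sat deg _ hdegSat
  have hle : Fintype.card J * S.card ≤ Sat.card * Fintype.card J := by
    rw [mul_comm]; exact Nat.mul_le_mul_right _ (by omega)
  have hunsat : ∑ p ∈ Finset.univ.filter (fun p => ¬ vertexWeight φ w p = 1), deg p = 0 := by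
    omega
  have hcard : Sat.card = S.card := by
    have h : Sat.card * Fintype.card J ≤ S.card * Fintype.card J := by
      rw [mul_comm S.card]
      omega
    have := Nat.le_of_mul_le_mul_right h (by omega)
    omega
  have hLsurj : Function.Surjective L := by
    rw [← LinearMap.injective_iff_surjective_of_finrank_eq_finrank]
    · exact hLinj
    · simp only [Module.finrank_fintype_fun_eq_card, Fintype.card_sum]
      omega
  have hsat : ∀ e, w e ≠ 0 → ∀ i, vertexWeight φ w (i, φ e i) = 1 := by
    intro e he i
    by_contra hp
    have := (Finset.sum_eq_zero_iff.1 hunsat) (i, φ e i) (by simp [hp])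
    simp only [deg, Finset.card_eq_zero, Finset.filter_eq_empty_iff] at this
    exact this (Finset.mem_filter.2 ⟨Finset.mem_univ e, he⟩) rfl
  obtain ⟨e₀, he₀⟩ := Function.ne_iff.1 hne
  obtain ⟨i, j, hij⟩ := exists_pair_ne J
  obtain ⟨z, hz⟩ := hLsurj (Pi.single (Sum.inl ⟨(i, φ e₀ i), hsat e₀ he₀ i⟩) 1)
  have hz0 : ∀ e, w e = 0 → z e = 0 := fun e he => by
    have := congrFun hz (Sum.inr ⟨e, he⟩)
    simpa [L] using this
  have hzp : ∀ p, vertexWeight φ z p = if p = (i, φ e₀ i) then 1 else 0 := by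
    intro p
    by_cases hp : vertexWeight φ w p = 1
    · have := congrFun hz (Sum.inl ⟨p, hp⟩)
      simpa [L, Pi.single_apply] using this
    · rw [if_neg (fun h : p = (i, φ e₀ i) => hp (h ▸ hsat e₀ he₀ i))]
      refine Finset.sum_eq_zero fun e _ => ?_
      split_ifs with h
      · refine hz0 e ?_
        by_contra he
        exact hp (by simpa [h] using hsat e he p.1)
      · rfl
  have h1 := sum_vertexWeight φ z i
  have h2 := sum_vertexWeight φ z j
  rw [← h2] at h1
  simp [hzp, hij.symm] at h1

/-- **Füredi's theorem for multipartite hypergraphs**: a fractional matching of a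
`J`-partite hypergraph contains in its support a matching of size at least its total weight
divided by `|J| - 1`. -/
theorem exists_matching_of_fractional_matching {E J V : Type*} [Fintype E] [Fintype J]
    [Nontrivial J] [Fintype V] [DecidableEq V] (φ : E → J → V) (w : E → ℝ) (hw : ∀ e, 0 ≤ w e)
    (hφ : ∀ p, vertexWeight φ w p ≤ 1) :
    ∃ M : Finset E, (∀ e ∈ M, w e ≠ 0) ∧ (∀ e ∈ M, ∀ f ∈ M, e ≠ f → ∀ i, φ e i ≠ φ f i) ∧
      ∑ e, w e ≤ ((Fintype.card J : ℝ) - 1) * M.card := by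
  classical
  induction hn : (Fintype.card (J × V) + 1) * (Finset.univ.filter fun e => w e ≠ 0).card +
    (Finset.univ.filter fun p => 1 - vertexWeight φ w p ≠ 0).card using Nat.strong_induction_on
    generalizing w with
  | _ n ih => ?_
  by_cases hw0 : w = 0
  · exact ⟨∅, by simp, by simp, by simp [hw0]⟩
  rcases exists_heavy_or_exists_direction (φ := φ) hw0 with ⟨e, he⟩ | ⟨z, hz, hzw, hzp⟩
  · have hwe : w e ≠ 0 := by
      rintro h
      rw [h, mul_zero] at he
      linarith
    let w' : E → ℝ := fun f => if ∃ i, φ f i = φ e i then 0 else w f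
    have hw'le : ∀ f, w' f ≤ w f := fun f => by
      simp only [w']; split_ifs
      exacts [hw f, le_rfl]
    have hw'nn : ∀ f, 0 ≤ w' f := fun f => by
      simp only [w']; split_ifs
      exacts [le_rfl, hw f]
    obtain ⟨i₀⟩ : Nonempty J := inferInstance
    have hsupp : (Finset.univ.filter fun f => w' f ≠ 0).card <
        (Finset.univ.filter fun f => w f ≠ 0).card := by
      refine Finset.card_lt_card (Finset.ssubset_iff_of_subset ?_ |>.2 ⟨e, by simp [hwe], by simp [w']⟩)
      intro f
      simp only [Finset.mem_filter, Finset.mem_univ, true_and, w']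
      split_ifs <;> simp
    have hunsat : (Finset.univ.filter fun p => 1 - vertexWeight φ w' p ≠ 0).card ≤
        Fintype.card (J × V) := Finset.card_le_univ _
    obtain ⟨M, hM, hMd, hMs⟩ := ih _ (by
      rw [← hn]
      have := Nat.mul_le_mul_left (Fintype.card (J × V) + 1) hsupp
      rw [Nat.succ_eq_add_one, mul_add] at this
      omega) w' hw'nn (fun p => le_trans (Finset.sum_le_sum fun f _ => by
        split_ifs
        exacts [hw'le f, le_rfl]) (hφ p)) rfl
    have hMe : ∀ f ∈ M, w f ≠ 0 ∧ ∀ i, φ f i ≠ φ e i := by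
      intro f hf
      have := hM f hf
      simp only [w'] at this
      split_ifs at this with h
      · exact absurd rfl this
      · exact ⟨this, not_exists.1 h⟩
    have heM : e ∉ M := fun h => (hMe e h).2 i₀ rfl
    refine ⟨insert e M, ?_, ?_, ?_⟩
    · intro f hf
      rcases Finset.mem_insert.1 hf with rfl | hf
      exacts [hwe, (hMe f hf).1]
    · intro f hf g hg hfg i
      rcases Finset.mem_insert.1 hf with hf' | hf' <;>
        rcases Finset.mem_insert.1 hg with hg' | hg'
      · exact absurd (hf'.trans hg'.symm) hfg
      · exact hf' ▸ ((hMe g hg').2 i).symm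
      · exact hg' ▸ (hMe f hf').2 i
      · exact hMd f hf' g hg' hfg i
    · rw [Finset.card_insert_of_notMem heM]
      have h1 := sum_meeting_le hw hφ e he
      have h2 : ∑ f, w f = (∑ f, if ∃ i, φ f i = φ e i then w f else 0) + ∑ f, w' f := by
        rw [← Finset.sum_add_distrib]
        exact Finset.sum_congr rfl fun f _ => by simp only [w']; split_ifs <;> simp
      push_cast
      rw [h2, mul_add, mul_one]
      linarith
  · wlog hzs : 0 ≤ ∑ e, z e generalizing z
    · refine this (-z) (neg_ne_zero.2 hz) (fun e he => by simp [hzw e he]) (fun p hp => ?_) ?_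
      · have := vertexWeight_const_mul φ z (-1) p
        simp only [neg_one_mul, hzp p hp, neg_zero] at this
        exact this
      · simp only [Pi.neg_apply, Finset.sum_neg_distrib]
        linarith
    let a : E ⊕ (J × V) → ℝ := Sum.elim w fun p => 1 - vertexWeight φ w p
    let b : E ⊕ (J × V) → ℝ := Sum.elim z fun p => - vertexWeight φ z p
    have hab : ∀ k, a k = 0 → b k = 0 := by
      rintro (e | p) h
      · exact hzw e h
      · have h' : vertexWeight φ w p = 1 := by
          have : 1 - vertexWeight φ w p = 0 := h
          linarith
        simp [b, hzp p h']
    obtain ⟨t, ht, htnn, k, hk, hkt⟩ := exists_first_zero (a := a) (b := b) (by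
        rintro (e | p)
        · exact hw e
        · simpa [a] using hφ p) (by
        by_cases hneg : ∃ e, z e < 0
        · obtain ⟨e, he⟩ := hneg
          exact ⟨Sum.inl e, he⟩
        · push Not at hneg
          obtain ⟨e, he⟩ := Function.ne_iff.1 hz
          obtain ⟨i₀⟩ : Nonempty J := inferInstance
          refine ⟨Sum.inr (i₀, φ e i₀), neg_lt_zero.2 ?_⟩
          refine Finset.sum_pos' (fun f _ => ?_) ⟨e, Finset.mem_univ e, ?_⟩
          · split_ifs
            exacts [hneg f, le_rfl]
          · rw [if_pos rfl]
            exact lt_of_le_of_ne (hneg e) (Ne.symm he))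
    have hak : a k ≠ 0 := fun h => hk.ne (hab k h)
    have hmeas : ∀ k, a k + t * b k ≠ 0 → a k ≠ 0 := fun k h h' => h (by simp [h', hab k h'])
    let w' : E → ℝ := fun e => w e + t * z e
    have hw'p : ∀ p, 1 - vertexWeight φ w' p = a (Sum.inr p) + t * b (Sum.inr p) := by
      intro p
      rw [vertexWeight_add_mul]
      simp only [a, b, Sum.elim_inr]
      ring
    have hs1 : (Finset.univ.filter fun e => w' e ≠ 0) ⊆ Finset.univ.filter fun e => w e ≠ 0 := by
      intro e
      simp only [Finset.mem_filter, Finset.mem_univ, true_and]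
      exact hmeas (Sum.inl e)
    have hs2 : (Finset.univ.filter fun p => 1 - vertexWeight φ w' p ≠ 0) ⊆
        Finset.univ.filter fun p => 1 - vertexWeight φ w p ≠ 0 := by
      intro p
      simp only [Finset.mem_filter, Finset.mem_univ, true_and, hw'p]
      exact hmeas (Sum.inr p)
    obtain ⟨M, hM, hMd, hMs⟩ := ih _ (by
      rw [← hn]
      have h1 := Nat.mul_le_mul_left (Fintype.card (J × V) + 1) (Finset.card_le_card hs1)
      have h2 := Finset.card_le_card hs2
      rcases k with e | p
      · have h3 := Finset.card_lt_card ((Finset.ssubset_iff_of_subset hs1).2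
          ⟨e, by simpa [a] using hak, by simpa [a, b, w'] using hkt⟩)
        have h4 := Nat.mul_lt_mul_of_pos_left h3 (Nat.succ_pos (Fintype.card (J × V)))
        exact Nat.add_lt_add_of_lt_of_le h4 h2
      · have h3 := Finset.card_lt_card ((Finset.ssubset_iff_of_subset hs2).2
          ⟨p, by simpa [a] using hak, by
            simp only [Finset.mem_filter, Finset.mem_univ, true_and, hw'p, hkt, not_not]⟩)
        exact Nat.add_lt_add_of_le_of_lt h1 h3) w' (fun e => htnn (Sum.inl e)) (fun p => by
        have := htnn (Sum.inr p)
        rw [← hw'p] at this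
        linarith) rfl
    refine ⟨M, fun e he => hmeas (Sum.inl e) (hM e he), hMd, le_trans ?_ hMs⟩
    simp only [w']
    rw [Finset.sum_add_distrib, ← Finset.mul_sum]
    have := mul_nonneg ht hzs
    linarith

/-- The `k`-th cut point of `[0, d]` for the subdivision into consecutive intervals with lengths
proportional to the coordinates of `x`. -/
def cutPoint (d : ℕ) {m : ℕ} (x : Fin m → ℝ) (k : ℕ) : ℝ :=
  d * ∑ j : Fin m, if (j : ℕ) < k then x j else 0

theorem cutPoint_zero (d : ℕ) {m : ℕ} (x : Fin m → ℝ) : cutPoint d x 0 = 0 := by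
  simp [cutPoint]

theorem cutPoint_eq_of_mem_stdSimplex (d : ℕ) {m : ℕ} {x : Fin m → ℝ}
    (hx : x ∈ stdSimplex ℝ (Fin m)) : cutPoint d x m = d := by
  simp [cutPoint, hx.2]

theorem cutPoint_mono (d : ℕ) {m : ℕ} {x : Fin m → ℝ} (hx : ∀ i, 0 ≤ x i) :
    Monotone (cutPoint d x) := by
  intro k l hkl
  refine mul_le_mul_of_nonneg_left (Finset.sum_le_sum fun j _ => ?_) (Nat.cast_nonneg d)
  split_ifs with h1 h2
  · exact le_rfl
  · omega
  · exact hx j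
  · exact le_rfl

theorem cutPoint_succ (d : ℕ) {m : ℕ} (x : Fin m → ℝ) (j : Fin m) :
    cutPoint d x (j + 1) = cutPoint d x j + d * x j := by
  have h : ∀ l : Fin m, (if (l : ℕ) < j + 1 then x l else 0) =
      (if (l : ℕ) < j then x l else 0) + if l = j then x l else 0 := by
    intro l
    rcases lt_trichotomy (l : ℕ) j with h | h | h
    · simp [h, Fin.ext_iff, h.ne, h.trans (Nat.lt_succ_self _)]
    · simp [Fin.ext_iff, h]
    · simp [Fin.ext_iff, h.ne', not_lt.2 h.le, not_lt.2 (Nat.succ_le_of_lt h)]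
  rw [cutPoint, Finset.sum_congr rfl fun l _ => h l, Finset.sum_add_distrib, mul_add]
  simp [cutPoint]

theorem continuous_cutPoint (d : ℕ) {m : ℕ} (k : ℕ) :
    Continuous fun x : Fin m → ℝ => cutPoint d x k := by
  unfold cutPoint
  refine continuous_const.mul (continuous_finsetSum _ fun j _ => ?_)
  split_ifs
  · exact continuous_apply j
  · exact continuous_const

/-- An interval in `(0, d)` avoiding all interior cut points lies strictly between two consecutive
cut points. -/
theorem exists_cutPoint_lt_and_lt {d N : ℕ} {x : Fin (N + 1) → ℝ}
    (hx : x ∈ stdSimplex ℝ (Fin (N + 1))) {a b : ℝ} (ha : 0 < a) (hb : b < d)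
    (hcut : ∀ k, k < N → cutPoint d x (k + 1) ∉ Set.Icc a b) :
    ∃ j : Fin (N + 1), cutPoint d x j < a ∧ b < cutPoint d x (j + 1) := by
  have hex : ∃ k, k < N + 1 ∧ b < cutPoint d x (k + 1) :=
    ⟨N, N.lt_succ_self, by rwa [cutPoint_eq_of_mem_stdSimplex d hx]⟩
  classical
  obtain ⟨hk, hkb⟩ := Nat.find_spec hex
  refine ⟨⟨Nat.find hex, hk⟩, ?_, hkb⟩
  change cutPoint d x (Nat.find hex) < a
  rcases hn : Nat.find hex with _ | n
  · simpa [cutPoint_zero] using ha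
  · have h1 : ¬ (n < N + 1 ∧ b < cutPoint d x (n + 1)) := Nat.find_min hex (by omega)
    have h2 : cutPoint d x (n + 1) ≤ b := by
      by_contra h
      exact h1 ⟨by omega, not_le.1 h⟩
    by_contra h
    exact hcut n (by omega) ⟨not_lt.1 h, h2⟩

/-- The clearance of the interval `[a, b]` inside the `j`-th interval of the subdivision given
by `x`, or `0` if it is not strictly inside. -/
def clearance (d : ℕ) {m : ℕ} (x : Fin m → ℝ) (a b : ℝ) (j : Fin m) : ℝ :=
  max 0 (min (a - cutPoint d x j) (cutPoint d x (j + 1) - b))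

theorem clearance_nonneg (d : ℕ) {m : ℕ} (x : Fin m → ℝ) (a b : ℝ) (j : Fin m) :
    0 ≤ clearance d x a b j := le_max_left _ _

theorem clearance_pos {d m : ℕ} {x : Fin m → ℝ} {a b : ℝ} {j : Fin m} :
    0 < clearance d x a b j ↔ cutPoint d x j < a ∧ b < cutPoint d x (j + 1) := by
  simp [clearance]

theorem continuous_clearance (d : ℕ) {m : ℕ} (a b : ℝ) (j : Fin m) :
    Continuous fun x : Fin m → ℝ => clearance d x a b j :=
  continuous_const.max ((continuous_const.sub (continuous_cutPoint d _)).min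
    ((continuous_cutPoint d _).sub continuous_const))

theorem clearance_eq_zero {d m : ℕ} {x : Fin m → ℝ} {a b : ℝ} {j : Fin m} (hab : a ≤ b)
    (hj : x j = 0) : clearance d x a b j = 0 := by
  refine le_antisymm (not_lt.1 fun h => ?_) (clearance_nonneg _ _ _ _ _)
  obtain ⟨h1, h2⟩ := clearance_pos.1 h
  rw [cutPoint_succ, hj, mul_zero, add_zero] at h2
  linarith

/-- If no set of `N` points covers a family of separated `d`-intervals, then for some subdivision
of `[0, d]` into `N + 1` intervals the edges avoiding the cut points support a fractional matching
of total weight `(N + 1) / d`. -/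
theorem exists_fractional_matching {d N : ℕ} (hd : 0 < d) (hN : 0 < N) {ι : Type*} [Fintype ι]
    {a b : ι → Fin d → ℝ} (hab : ∀ h i, a h i ≤ b h i) (ha : ∀ h i, 0 < a h i)
    (hb : ∀ h i, b h i < d)
    (hcov : ∀ C : Finset ℝ, C.card ≤ N → ∃ h, ∀ i, ∀ p ∈ C, p ∉ Set.Icc (a h i) (b h i)) :
    ∃ x ∈ stdSimplex ℝ (Fin (N + 1)), ∃ w : ι × (Fin d → Fin (N + 1)) → ℝ,
      (∀ e, 0 ≤ w e) ∧
      (∀ e, w e ≠ 0 → ∀ i, cutPoint d x (e.2 i) < a e.1 i ∧ b e.1 i < cutPoint d x (e.2 i + 1)) ∧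
      (∀ p, vertexWeight Prod.snd w p ≤ 1) ∧ ∑ e, w e = (N + 1) / d := by
  classical
  have : Nontrivial (Fin (N + 1)) := Fin.nontrivial_iff_two_le.2 (by omega)
  let E := ι × (Fin d → Fin (N + 1))
  let W : (Fin (N + 1) → ℝ) → E → ℝ := fun x e => ∏ i, clearance d x (a e.1 i) (b e.1 i) (e.2 i)
  have hWnn : ∀ x e, 0 ≤ W x e := fun x e =>
    Finset.prod_nonneg fun i _ => clearance_nonneg _ _ _ _ _
  have hWcont : ∀ e, Continuous fun x => W x e := fun e =>
    continuous_finsetProd _ fun i _ => continuous_clearance _ _ _ _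
  let F : (Fin (N + 1) → ℝ) → ℝ := fun x => ∑ e, W x e
  let G : Fin (N + 1) → (Fin (N + 1) → ℝ) → ℝ := fun j x =>
    ∑ i : Fin d, vertexWeight Prod.snd (W x) (i, j)
  have hFcont : Continuous F := continuous_finsetSum _ fun e _ => hWcont e
  have hvnn : ∀ x p, 0 ≤ vertexWeight Prod.snd (W x) p := fun x p =>
    Finset.sum_nonneg fun e _ => by
      split_ifs
      exacts [hWnn x e, le_rfl]
  have hGcont : ∀ j, Continuous (G j) := fun j => by
    refine continuous_finsetSum _ fun i _ => ?_
    unfold vertexWeight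
    refine continuous_finsetSum _ fun e _ => ?_
    split_ifs
    exacts [hWcont e, continuous_const]
  have hGsum : ∀ x, ∑ j, G j x = d * F x := fun x => by
    simp only [G]
    rw [Finset.sum_comm, Finset.sum_congr rfl fun i _ => sum_vertexWeight Prod.snd (W x) i]
    rw [Finset.sum_const, Finset.card_univ, Fintype.card_fin, nsmul_eq_mul]
  have hFnn : ∀ x, 0 ≤ F x := fun x => Finset.sum_nonneg fun e _ => hWnn x e
  obtain ⟨x, hx, hxA⟩ := exists_mem_stdSimplex_forall_mem
    (A := fun j => {x | ((N : ℝ) + 1) * G j x ≤ d * F x})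
    (fun j => isClosed_le (continuous_const.mul (hGcont j)) (continuous_const.mul hFcont))
    (fun x _ => by
      by_contra! hcon
      have h := Finset.sum_lt_sum_of_nonempty Finset.univ_nonempty fun j _ =>
        show (d : ℝ) * F x < ((N : ℝ) + 1) * G j x from not_le.1 (hcon j)
      rw [← Finset.mul_sum Finset.univ (fun j => G j x), hGsum, Finset.sum_const,
        Finset.card_univ, Fintype.card_fin, nsmul_eq_mul] at h
      push_cast at h
      exact lt_irrefl _ h)
    (fun x _ j hj => by
      have hG : G j x = 0 := by
        refine Finset.sum_eq_zero fun i _ => Finset.sum_eq_zero fun e _ => ?_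
        split_ifs with h
        · refine Finset.prod_eq_zero (Finset.mem_univ i) (clearance_eq_zero (hab _ _) ?_)
          rw [← hj]
          exact congrArg x h
        · rfl
      rw [Set.mem_ofPred_eq, hG, mul_zero]
      exact mul_nonneg (Nat.cast_nonneg d) (hFnn x))
  have hFpos : 0 < F x := by
    obtain ⟨h, hh⟩ := hcov ((Finset.range N).image fun k => cutPoint d x (k + 1))
      (Finset.card_image_le.trans (Finset.card_range N).le)
    choose T hT using fun i => exists_cutPoint_lt_and_lt hx (ha h i) (hb h i) fun k hk =>
      hh i _ (Finset.mem_image_of_mem _ (Finset.mem_range.2 hk))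
    refine Finset.sum_pos' (fun e _ => hWnn x e) ⟨(h, T), Finset.mem_univ _, ?_⟩
    exact Finset.prod_pos fun i _ => clearance_pos.2 (hT i)
  have hd' : (0 : ℝ) < d := Nat.cast_pos.2 hd
  have hdF : 0 < d * F x := mul_pos hd' hFpos
  refine ⟨x, hx, fun e => ((N : ℝ) + 1) / (d * F x) * W x e, fun e => ?_, fun e he i => ?_,
    fun p => ?_, ?_⟩
  · exact mul_nonneg (by positivity) (hWnn x e)
  · have h := Finset.prod_ne_zero_iff.1 (right_ne_zero_of_mul he) i (Finset.mem_univ i)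
    exact clearance_pos.1 (lt_of_le_of_ne (clearance_nonneg _ _ _ _ _) h.symm)
  · rw [vertexWeight_const_mul, div_mul_eq_mul_div, div_le_one hdF]
    refine le_trans (mul_le_mul_of_nonneg_left ?_ (by positivity)) (hxA p.2)
    exact Finset.single_le_sum (f := fun i => vertexWeight Prod.snd (W x) (i, p.2))
      (fun i _ => hvnn x _) (Finset.mem_univ p.1)
  · rw [← Finset.mul_sum]
    change ((N : ℝ) + 1) / (d * F x) * F x = _
    field_simp

theorem le_matchingNumber {F M : Finset (Set ℝ)} (hM : IsMatching F M) :
    M.card ≤ matchingNumber F := by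
  refine le_csSup ⟨F.card, ?_⟩ ⟨M, hM, rfl⟩
  rintro _ ⟨M', hM', rfl⟩
  exact Finset.card_le_card hM'.1

theorem piercingNumber_le {F : Finset (Set ℝ)} {C : Finset ℝ} (hC : IsCover F C) :
    piercingNumber F ≤ C.card :=
  Nat.sInf_le ⟨C, hC, rfl⟩

/-- **Tardos–Kaiser theorem, separated case.** In every hypergraph `H` of separated
`d`-intervals (`d ≥ 2`), `τ(H) ≤ (d² - d) ν(H)`. -/
theorem tardos_kaiser_separated (d : ℕ) (hd : 2 ≤ d) (H : Finset (Set ℝ))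
    (hH : ∀ e ∈ H, IsSeparatedDInterval d e) :
    piercingNumber H ≤ (d ^ 2 - d) * matchingNumber H := by
  classical
  by_contra! hlt
  set N := (d ^ 2 - d) * matchingNumber H with hNdef
  have hsq : d ^ 2 - d = d * (d - 1) := by rw [pow_two, Nat.mul_sub_one]
  choose a b hab hsub hunion using fun h : H => hH h.1 h.2
  have hmem : ∀ (h : H) (i : Fin d), a h i ∈ Set.Ioo (i : ℝ) (i + 1) ∧ b h i ∈ Set.Ioo (i : ℝ) (i + 1) :=
    fun h i => ⟨hsub h i (Set.left_mem_Icc.2 (hab h i)), hsub h i (Set.right_mem_Icc.2 (hab h i))⟩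
  have hne : H.Nonempty := by
    rw [Finset.nonempty_iff_ne_empty]
    rintro rfl
    have h := piercingNumber_le (F := ∅) (C := ∅) (fun e he => absurd he (Finset.notMem_empty e))
    rw [Finset.card_empty] at h
    omega
  have hν : 0 < matchingNumber H := by
    obtain ⟨e, he⟩ := hne
    have h := le_matchingNumber (F := H) (M := {e}) ⟨by simpa using he, fun x hx y hy hxy =>
      absurd ((Finset.mem_singleton.1 hx).trans (Finset.mem_singleton.1 hy).symm) hxy⟩
    rwa [Finset.card_singleton] at h
  have hN : 0 < N := by
    rw [hNdef, hsq]
    exact Nat.mul_pos (Nat.mul_pos (by omega) (by omega)) hν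
  obtain ⟨x, hx, w, hwnn, hwcut, hwle, hwsum⟩ := exists_fractional_matching (N := N)
    (by omega : 0 < d) hN hab
    (fun h i => lt_of_le_of_lt (Nat.cast_nonneg _) (hmem h i).1.1)
    (fun h i => lt_of_lt_of_le (hmem h i).2.2 (by
      have := Nat.succ_le_of_lt i.2
      exact_mod_cast this))
    (fun C hC => by
      by_contra! hcon
      refine absurd (piercingNumber_le (F := H) (C := C) fun e he => ?_) (by omega)
      obtain ⟨i, p, hp, hpi⟩ := hcon ⟨e, he⟩
      refine ⟨p, hp, ?_⟩
      have h := hunion ⟨e, he⟩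
      dsimp only at h
      rw [h]
      exact Set.mem_iUnion.2 ⟨i, hpi⟩)
  have : Nontrivial (Fin d) := Fin.nontrivial_iff_two_le.2 hd
  obtain ⟨M, hMw, hMd, hMs⟩ := exists_matching_of_fractional_matching Prod.snd w hwnn hwle
  have hdisj : ∀ e ∈ M, ∀ f ∈ M, e ≠ f → Disjoint e.1.1 f.1.1 := by
    intro e he f hf hef
    rw [Set.disjoint_left, hunion e.1, hunion f.1]
    intro p hpe hpf
    obtain ⟨i, hi⟩ := Set.mem_iUnion.1 hpe
    obtain ⟨j, hj⟩ := Set.mem_iUnion.1 hpf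
    have hi' := hsub e.1 i hi
    have hj' := hsub f.1 j hj
    have hij : i = j := by
      have h1 : (i : ℝ) < j + 1 := hi'.1.trans hj'.2
      have h2 : (j : ℝ) < i + 1 := hj'.1.trans hi'.2
      have h1' : (i : ℕ) < j + 1 := by exact_mod_cast h1
      have h2' : (j : ℕ) < i + 1 := by exact_mod_cast h2
      exact Fin.ext (by omega)
    subst hij
    have hce := hwcut e (hMw e he) i
    have hcf := hwcut f (hMw f hf) i
    have hmono := cutPoint_mono d hx.1
    rcases lt_or_gt_of_ne (hMd e he f hf hef i) with h | h
    · have := hmono (Nat.succ_le_of_lt (Fin.lt_def.1 h))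
      simp only [Nat.succ_eq_add_one] at this
      linarith [hi.2, hj.1]
    · have := hmono (Nat.succ_le_of_lt (Fin.lt_def.1 h))
      simp only [Nat.succ_eq_add_one] at this
      linarith [hj.2, hi.1]
  have hinj : Set.InjOn (fun e : H × (Fin d → Fin (N + 1)) => e.1.1) M := by
    intro e he f hf hef
    by_contra hne'
    have h := hdisj e he f hf hne'
    simp only at hef
    rw [← hef, disjoint_self] at h
    have hmem : a e.1 ⟨0, by omega⟩ ∈ e.1.1 := by
      rw [hunion e.1]
      exact Set.mem_iUnion.2 ⟨⟨0, by omega⟩, Set.left_mem_Icc.2 (hab _ _)⟩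
    rw [h] at hmem
    exact hmem
  have hMν : M.card ≤ matchingNumber H := by
    rw [← Finset.card_image_of_injOn hinj]
    refine le_matchingNumber ⟨?_, ?_⟩
    · intro h hh
      obtain ⟨e, -, rfl⟩ := Finset.mem_image.1 hh
      exact e.1.2
    · intro s hs t ht hst
      obtain ⟨e, he, rfl⟩ := Finset.mem_image.1 hs
      obtain ⟨f, hf, rfl⟩ := Finset.mem_image.1 ht
      exact hdisj e he f hf fun h => hst (h ▸ rfl)
  rw [hwsum, Fintype.card_fin, div_le_iff₀ (by positivity)] at hMs
  have hcast : ((d - 1 : ℕ) : ℝ) = (d : ℝ) - 1 := by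
    rw [Nat.cast_sub (by omega), Nat.cast_one]
  rw [← hcast] at hMs
  have hfin : N + 1 ≤ (d - 1) * M.card * d := by exact_mod_cast hMs
  have hle : (d - 1) * M.card * d ≤ (d ^ 2 - d) * matchingNumber H :=
    calc (d - 1) * M.card * d = d * (d - 1) * M.card := by ring
      _ ≤ d * (d - 1) * matchingNumber H := Nat.mul_le_mul_left _ hMν
      _ = (d ^ 2 - d) * matchingNumber H := by rw [hsq]
  rw [← hNdef] at hle
  omega
end

section
/- If H is a finite d-partite hypergraph of rank d ≥ 2, then ν(H) ≥ ν*(H)/(d − 1). -/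
open Finset in
/-- Along a direction that decreases some coordinate and fixes the vanishing ones, a nonnegative
vector can be moved until a positive coordinate vanishes. -/
theorem exists_step_to_boundary {ι : Type*} (s : Finset ι) (a b : ι → ℝ)
    (ha : ∀ i ∈ s, 0 ≤ a i) (hab : ∀ i ∈ s, a i = 0 → b i = 0) (hb : ∃ i ∈ s, b i < 0) :
    ∃ t : ℝ, 0 ≤ t ∧ (∀ i ∈ s, 0 ≤ a i + t * b i) ∧ ∃ i ∈ s, 0 < a i ∧ a i + t * b i = 0 := by
  classical
  obtain ⟨j, hj, hmin⟩ := exists_min_image (s.filter fun i => b i < 0) (fun i => a i / -b i)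
    (by obtain ⟨i, hi, hi'⟩ := hb; exact ⟨i, by simp [hi, hi']⟩)
  obtain ⟨hjs, hjb⟩ := mem_filter.1 hj
  have hjt : 0 ≤ a j / -b j := div_nonneg (ha j hjs) (by linarith)
  refine ⟨a j / -b j, hjt, fun i hi => ?_, j, hjs, ?_, ?_⟩
  · rcases lt_or_ge (b i) 0 with h | h
    · have := hmin i (by simp [hi, h])
      rw [le_div_iff₀ (by linarith)] at this
      linarith
    · have := ha i hi
      positivity
  · exact lt_of_le_of_ne (ha j hjs) fun h => hjb.ne (hab j hjs h.symm)
  · have : b j ≠ 0 := hjb.ne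
    field_simp
    ring

open Finset in
/-- Every fractional matching is dominated in total weight by one that is determined, among the
functions with the same support, by its saturated vertices. -/
theorem exists_basic_fractional_matching {V : Type*} [DecidableEq V] (E : Finset (Finset V))
    (hne : ∀ e ∈ E, e.Nonempty) (f : Finset V → ℝ) (hf0 : ∀ e ∈ E, 0 ≤ f e)
    (hfm : ∀ v : V, ∑ e ∈ E with v ∈ e, f e ≤ 1) :
    ∃ g : Finset V → ℝ, (∀ e ∈ E, 0 ≤ g e) ∧ (∀ v : V, ∑ e ∈ E with v ∈ e, g e ≤ 1) ∧
      ∑ e ∈ E, f e ≤ ∑ e ∈ E, g e ∧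
      ∀ y : Finset V → ℝ, (∀ e ∈ E, g e = 0 → y e = 0) →
        (∀ v, ∑ e ∈ E with v ∈ e, g e = 1 → ∑ e ∈ E with v ∈ e, y e = 0) →
        ∀ e ∈ E, y e = 0 := by
  let I : Finset (Finset V ⊕ V) := E.disjSum (E.biUnion id)
  let slack (g : Finset V → ℝ) : Finset V ⊕ V → ℝ :=
    Sum.elim g fun v => 1 - ∑ e ∈ E with v ∈ e, g e
  induction hn : #{i ∈ I | 0 < slack f i} using Nat.strong_induction_on generalizing f with
  | _ n ih =>
  by_contra! hcon
  obtain ⟨y, hy0, hyT, e₀, he₀, hye₀⟩ := hcon f hf0 hfm le_rfl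
  wlog hsum : 0 ≤ ∑ e ∈ E, y e generalizing y
  · refine this (fun e => -y e) (fun e he h => by simp [hy0 e he h])
      (fun v hv => by simp [hyT v hv]) (by simpa using hye₀) ?_
    rw [sum_neg_distrib]
    linarith
  let b : Finset V ⊕ V → ℝ := Sum.elim y fun v => -∑ e ∈ E with v ∈ e, y e
  have hslack0 : ∀ i ∈ I, 0 ≤ slack f i := by
    rintro (e | v) hi
    · exact hf0 e (by simpa [I] using hi)
    · simpa [slack] using hfm v
  have hdir : ∀ i ∈ I, slack f i = 0 → b i = 0 := by
    rintro (e | v) hi h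
    · exact hy0 e (by simpa [I] using hi) h
    · have : ∑ e ∈ E with v ∈ e, f e = 1 := by
        simp only [slack, Sum.elim_inr] at h
        linarith
      simp [b, hyT v this]
  have hneg : ∃ i ∈ I, b i < 0 := by
    by_contra! hnn
    have hynn : ∀ e ∈ E, 0 ≤ y e := fun e he => hnn (Sum.inl e) (by simpa [I] using he)
    obtain ⟨v, hv⟩ := hne e₀ he₀
    have h1 : 0 ≤ -∑ e ∈ E with v ∈ e, y e :=
      hnn (Sum.inr v) (by simpa [I] using ⟨e₀, he₀, hv⟩)
    have h2 : y e₀ ≤ ∑ e ∈ E with v ∈ e, y e :=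
      single_le_sum (f := y) (fun e he => hynn e (mem_filter.1 he).1) (by simp [he₀, hv])
    exact hye₀ (le_antisymm (by linarith) (hynn e₀ he₀))
  obtain ⟨t, ht, hnn, j, hj, hjpos, hjzero⟩ := exists_step_to_boundary I _ b hslack0 hdir hneg
  have hmove : ∀ i, slack (fun e => f e + t * y e) i = slack f i + t * b i := by
    rintro (e | v)
    · rfl
    · simp only [slack, b, Sum.elim_inr, sum_add_distrib, ← mul_sum]
      ring
  have hlt : #{i ∈ I | 0 < slack (fun e => f e + t * y e) i} < n := by
    rw [← hn]
    refine card_lt_card ⟨fun i hi => ?_, fun h => ?_⟩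
    · rw [mem_filter, hmove] at hi
      refine mem_filter.2 ⟨hi.1, lt_of_le_of_ne (hslack0 i hi.1) fun h => ?_⟩
      rw [hdir i hi.1 h.symm, ← h] at hi
      simp at hi
    · have := (mem_filter.1 (h (mem_filter.2 ⟨hj, hjpos⟩))).2
      rw [hmove, hjzero] at this
      exact this.false
  have hadd : ∑ e ∈ E, f e ≤ ∑ e ∈ E, (f e + t * y e) := by
    rw [sum_add_distrib, ← mul_sum]
    have := mul_nonneg ht hsum
    linarith
  obtain ⟨g, hg0, hgm, hfg, hg⟩ := ih _ hlt (fun e => f e + t * y e)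
    (fun e he => hnn (Sum.inl e) (by simpa [I] using he))
    (fun v => by
      by_cases hv : v ∈ E.biUnion id
      · have := hnn (Sum.inr v) (by simpa [I] using hv)
        rw [← hmove] at this
        simpa [slack] using this
      · rw [filter_false_of_mem (p := (v ∈ ·)) fun e he hve => hv (mem_biUnion.2 ⟨e, he, hve⟩)]
        simp) rfl
  obtain ⟨z, hz0, hzT, e, he, hze⟩ := hcon g hg0 hgm (hadd.trans hfg)
  exact hze (hg z hz0 hzT e he)

open Finset in
/-- If the incidence map from functions on the edge set `S` to functions on the vertex set `T` is
injective, while some vertex weighting, nonzero somewhere on each edge, sums to zero over each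
edge, then some vertex of `T` has degree less than the rank. -/
theorem exists_degree_lt_of_incidence_injective {V : Type*} [DecidableEq V] (d : ℕ)
    (S : Finset (Finset V)) (hS : S.Nonempty) (hcard : ∀ e ∈ S, #e ≤ d) (T : Finset V)
    (w : V → ℝ) (hw : ∀ e ∈ S, ∑ v ∈ e, w v = 0) (hw0 : ∀ e ∈ S, ∃ v ∈ e, w v ≠ 0)
    (hinj : ∀ y : S → ℝ, (∀ v ∈ T, ∑ e : S, (if v ∈ e.1 then y e else 0) = 0) → y = 0) :
    ∃ v ∈ T, #{e ∈ S | v ∈ e} < d := by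
  by_contra! hdeg
  let L : (S → ℝ) →ₗ[ℝ] (T → ℝ) :=
    { toFun := fun y v => ∑ e : S, if v.1 ∈ e.1 then y e else 0
      map_add' := fun x y => by
        ext v
        simp only [Pi.add_apply, ← sum_add_distrib]
        exact sum_congr rfl fun e _ => by split_ifs <;> simp
      map_smul' := fun c y => by
        ext v
        simp [mul_sum] }
  have hL : Function.Injective L := by
    refine (injective_iff_map_eq_zero L).2 fun y hy => hinj y fun v hv => ?_
    exact congrFun hy ⟨v, hv⟩
  have hST : #S ≤ #T := by simpa using LinearMap.finrank_le_finrank_of_injective hL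
  have hcount : ∑ v ∈ T, #{e ∈ S | v ∈ e} = ∑ e ∈ S, #{v ∈ T | v ∈ e} :=
    sum_card_bipartiteAbove_eq_sum_card_bipartiteBelow _
  have hle : ∀ e ∈ S, #{v ∈ T | v ∈ e} ≤ #e := fun e _ =>
    card_le_card fun v hv => (mem_filter.1 hv).2
  have hlow : #T * d ≤ ∑ v ∈ T, #{e ∈ S | v ∈ e} := by
    simpa using card_nsmul_le_sum T _ d hdeg
  have hmul : #S * d ≤ #T * d := Nat.mul_le_mul_right d hST
  have hupp : ∑ e ∈ S, #{v ∈ T | v ∈ e} ≤ #S * d := by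
    simpa using sum_le_card_nsmul S _ d fun e he => (hle e he).trans (hcard e he)
  have hfull : ∀ e ∈ S, #{v ∈ T | v ∈ e} = d :=
    (sum_eq_sum_iff_of_le fun e he => (hle e he).trans (hcard e he)).1
      (by rw [sum_const, smul_eq_mul]; omega)
  have hsub : ∀ e ∈ S, {v ∈ T | v ∈ e} = e := fun e he =>
    eq_of_subset_of_card_le (fun v hv => (mem_filter.1 hv).2) (by
      rw [hfull e he]; exact hcard e he)
  obtain ⟨e₀, he₀⟩ := hS
  obtain ⟨v₀, hv₀, hwv₀⟩ := hw0 e₀ he₀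
  have hv₀T : v₀ ∈ T := by
    rw [← hsub e₀ he₀] at hv₀
    exact (mem_filter.1 hv₀).1
  have hd : 0 < d := (card_pos.2 ⟨v₀, hv₀⟩).trans_le (hcard e₀ he₀)
  have hTS : #S = #T :=
    le_antisymm hST (Nat.le_of_mul_le_mul_right (by omega) hd)
  have hsurj : Function.Surjective L :=
    (LinearMap.injective_iff_surjective_of_finrank_eq_finrank (by simpa using hTS)).1 hL
  obtain ⟨y, hy⟩ := hsurj (Pi.single ⟨v₀, hv₀T⟩ 1)
  have hzero : ∑ v : T, w v * L y v = 0 := by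
    calc ∑ v : T, w v * L y v
        = ∑ v ∈ T, ∑ e : S, w v * (if v ∈ e.1 then y e else 0) := by
          rw [← sum_coe_sort T]
          exact sum_congr rfl fun v _ => mul_sum _ _ _
      _ = ∑ e : S, ∑ v ∈ T, w v * (if v ∈ e.1 then y e else 0) := sum_comm
      _ = ∑ e : S, (∑ v ∈ e.1, w v) * y e := by
          refine sum_congr rfl fun e _ => ?_
          conv_rhs => rw [← hsub e.1 e.2]
          rw [sum_filter, sum_mul]
          exact sum_congr rfl fun v _ => by split_ifs <;> simp
      _ = 0 := sum_eq_zero fun e _ => by rw [hw e.1 e.2, zero_mul]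
  rw [hy] at hzero
  simp [Pi.single_apply] at hzero
  exact hwv₀ hzero

open Finset in
/-- A nonzero fractional matching of a hypergraph of rank `d` that is determined by its support and
saturated vertices gives weight at least `1 / (d - 1)` to some edge. -/
theorem exists_heavy_edge {V : Type*} [DecidableEq V] (d : ℕ) (E : Finset (Finset V))
    (hcard : ∀ e ∈ E, #e ≤ d) (w : V → ℝ) (hw : ∀ e ∈ E, ∑ v ∈ e, w v = 0)
    (hw0 : ∀ e ∈ E, ∃ v ∈ e, w v ≠ 0) (g : Finset V → ℝ) (hg0 : ∀ e ∈ E, 0 ≤ g e)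
    (hpos : ∃ e ∈ E, 0 < g e)
    (hg : ∀ y : Finset V → ℝ, (∀ e ∈ E, g e = 0 → y e = 0) →
      (∀ v, ∑ e ∈ E with v ∈ e, g e = 1 → ∑ e ∈ E with v ∈ e, y e = 0) → ∀ e ∈ E, y e = 0) :
    ∃ e ∈ E, 1 ≤ ((d : ℝ) - 1) * g e := by
  let S : Finset (Finset V) := {e ∈ E | 0 < g e}
  let T : Finset V := {v ∈ E.biUnion id | ∑ e ∈ E with v ∈ e, g e = 1}
  have hSE : ∀ e ∈ S, e ∈ E := fun e he => (mem_filter.1 he).1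
  have hinj : ∀ y : S → ℝ,
      (∀ v ∈ T, ∑ e : S, (if v ∈ e.1 then y e else 0) = 0) → y = 0 := by
    intro y hy
    let z : Finset V → ℝ := fun e => if h : e ∈ S then y ⟨e, h⟩ else 0
    have hz := hg z
      (fun e _ h => dif_neg fun hS => (mem_filter.1 hS).2.ne' h)
      (fun v hv => by
        have hvT : v ∈ T := by
          refine mem_filter.2 ⟨?_, hv⟩
          obtain ⟨e, he, -⟩ := exists_ne_zero_of_sum_ne_zero (hv.trans_ne one_ne_zero)
          exact mem_biUnion.2 ⟨e, (mem_filter.1 he).1, (mem_filter.1 he).2⟩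
        rw [← hy v hvT, sum_filter]
        calc ∑ e ∈ E, (if v ∈ e then z e else 0)
            = ∑ e ∈ S, (if v ∈ e then z e else 0) := by
              refine (sum_subset (fun e he => hSE e he) fun e _ he => ?_).symm
              simp [z, he]
          _ = ∑ e : S, (if v ∈ e.1 then y e else 0) := by
              rw [← sum_coe_sort S]
              exact sum_congr rfl fun e _ => by simp [z])
    ext e
    simpa [z] using hz e.1 (hSE e.1 e.2)
  obtain ⟨v, hvT, hv⟩ := exists_degree_lt_of_incidence_injective d S
    (by obtain ⟨e, he, h⟩ := hpos; exact ⟨e, mem_filter.2 ⟨he, h⟩⟩)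
    (fun e he => hcard e (hSE e he)) T w (fun e he => hw e (hSE e he))
    (fun e he => hw0 e (hSE e he)) hinj
  have hsum : ∑ e ∈ S with v ∈ e, g e = 1 := by
    rw [← (mem_filter.1 hvT).2]
    refine sum_subset (filter_subset_filter _ (filter_subset _ _)) fun e he heS => ?_
    obtain ⟨heE, hve⟩ := mem_filter.1 he
    by_contra h
    exact heS (mem_filter.2 ⟨mem_filter.2 ⟨heE, lt_of_le_of_ne (hg0 e heE) (Ne.symm h)⟩, hve⟩)
  obtain ⟨e, he, hmax⟩ := exists_max_image {e ∈ S | v ∈ e} g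
    (nonempty_of_sum_ne_zero (hsum.trans_ne one_ne_zero))
  refine ⟨e, hSE e (mem_filter.1 he).1, ?_⟩
  have hge : 0 ≤ g e := hg0 e (hSE e (mem_filter.1 he).1)
  have hdeg : (#{e ∈ S | v ∈ e} : ℝ) ≤ (d : ℝ) - 1 := by
    have : (#{e ∈ S | v ∈ e} : ℝ) + 1 ≤ d := by exact_mod_cast hv
    linarith
  calc 1 = ∑ e ∈ S with v ∈ e, g e := hsum.symm
    _ ≤ #{e ∈ S | v ∈ e} * g e := by simpa using sum_le_card_nsmul _ g _ hmax
    _ ≤ ((d : ℝ) - 1) * g e := mul_le_mul_of_nonneg_right hdeg hge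

open Finset in
/-- The edges meeting an edge of weight at least `1 / (d - 1)` have total weight at most
`d - 1`. -/
theorem sum_edges_meeting_le {V : Type*} [DecidableEq V] (d : ℕ) (E : Finset (Finset V))
    (g : Finset V → ℝ) (hg0 : ∀ e ∈ E, 0 ≤ g e) (hgm : ∀ v : V, ∑ e ∈ E with v ∈ e, g e ≤ 1)
    (e : Finset V) (he : e ∈ E) (hcard : #e = d) (hheavy : 1 ≤ ((d : ℝ) - 1) * g e) :
    ∑ e' ∈ E with ¬Disjoint e e', g e' ≤ (d : ℝ) - 1 := by
  have htotal : ∑ e' ∈ E, (#(e ∩ e') : ℝ) * g e' ≤ d := by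
    calc ∑ e' ∈ E, (#(e ∩ e') : ℝ) * g e'
        = ∑ e' ∈ E, ∑ v ∈ e, (if v ∈ e' then g e' else 0) := by
          refine sum_congr rfl fun e' _ => ?_
          rw [← sum_filter, filter_mem_eq_inter, sum_const, nsmul_eq_mul]
      _ = ∑ v ∈ e, ∑ e' ∈ E with v ∈ e', g e' := by
          rw [sum_comm]
          exact sum_congr rfl fun v _ => (sum_filter _ _).symm
      _ ≤ d := by simpa [hcard] using sum_le_card_nsmul e _ 1 fun v _ => hgm v
  have hterm : ∑ e' ∈ E, ((if Disjoint e e' then 0 else g e') +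
      if e' = e then ((d : ℝ) - 1) * g e else 0) ≤ ∑ e' ∈ E, (#(e ∩ e') : ℝ) * g e' := by
    refine sum_le_sum fun e' he' => ?_
    have hge' := hg0 e' he'
    by_cases h : e' = e
    · subst h
      rw [inter_self, hcard]
      split_ifs <;> nlinarith
    · rw [if_neg h, add_zero]
      split_ifs with hdisj
      · positivity
      · have : 1 ≤ #(e ∩ e') := card_pos.2 (not_disjoint_iff_nonempty_inter.1 hdisj)
        exact le_mul_of_one_le_left hge' (by exact_mod_cast this)
  rw [sum_add_distrib, sum_ite_eq' E e, if_pos he] at hterm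
  rw [sum_filter]
  simp only [ite_not]
  linarith

open Finset in
/-- Füredi's bound for `d`-uniform hypergraphs carrying a vertex weighting that sums to zero over
each edge without vanishing on it. -/
theorem exists_matching_of_balanced {V : Type*} [DecidableEq V] (d : ℕ) (w : V → ℝ)
    (E : Finset (Finset V)) (hcard : ∀ e ∈ E, #e = d) (hw : ∀ e ∈ E, ∑ v ∈ e, w v = 0)
    (hw0 : ∀ e ∈ E, ∃ v ∈ e, w v ≠ 0) (f : Finset V → ℝ) (hf0 : ∀ e ∈ E, 0 ≤ f e)
    (hfm : ∀ v : V, ∑ e ∈ E with v ∈ e, f e ≤ 1) :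
    ∃ M ⊆ E, (∀ e ∈ M, ∀ e' ∈ M, e ≠ e' → Disjoint e e') ∧
      ∑ e ∈ E, f e ≤ #M * ((d : ℝ) - 1) := by
  induction E using Finset.strongInduction generalizing f with
  | H E ih =>
  obtain ⟨g, hg0, hgm, hfg, hg⟩ := exists_basic_fractional_matching E
    (fun e he => (hw0 e he).imp fun _ h => h.1) f hf0 hfm
  by_cases hpos : ∃ e ∈ E, 0 < g e
  · obtain ⟨e, he, hheavy⟩ := exists_heavy_edge d E (fun e he => (hcard e he).le) w hw hw0 g hg0
      hpos hg
    have hmeet := sum_edges_meeting_le d E g hg0 hgm e he (hcard e he) hheavy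
    have hself : ¬Disjoint e e := by
      obtain ⟨v, hv, -⟩ := hw0 e he
      exact not_disjoint_iff.2 ⟨v, hv, hv⟩
    have hsub : {e' ∈ E | Disjoint e e'} ⊆ E := filter_subset _ _
    obtain ⟨M, hME, hM, hMcard⟩ := ih {e' ∈ E | Disjoint e e'}
      (filter_ssubset.2 ⟨e, he, hself⟩)
      (fun e' h => hcard e' (hsub h)) (fun e' h => hw e' (hsub h)) (fun e' h => hw0 e' (hsub h))
      g (fun e' h => hg0 e' (hsub h))
      (fun v => (sum_le_sum_of_subset_of_nonneg (filter_subset_filter _ hsub)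
        fun e' he' _ => hg0 e' (mem_filter.1 he').1).trans (hgm v))
    have heM : ∀ e' ∈ M, Disjoint e e' := fun e' h => (mem_filter.1 (hME h)).2
    refine ⟨insert e M, insert_subset he (hME.trans hsub), ?_, ?_⟩
    · intro a ha b hb hab
      rcases mem_insert.1 ha with rfl | haM <;> rcases mem_insert.1 hb with rfl | hbM
      · exact absurd rfl hab
      · exact heM b hbM
      · exact (heM a haM).symm
      · exact hM a haM b hbM hab
    · rw [card_insert_of_notMem fun h => hself (heM e h)]
      have := sum_filter_add_sum_filter_not E (fun e' => Disjoint e e') g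
      push_cast
      linarith
  · push Not at hpos
    exact ⟨∅, empty_subset _, by simp, by simpa using hfg.trans (sum_nonpos hpos)⟩


/-- **Füredi's theorem, `d`-partite case.** If `H = (V, E)` is a finite `d`-partite
hypergraph of rank `d ≥ 2`, then `ν(H) ≥ ν*(H)/(d - 1)`: for every fractional matching `f`
there is a matching `M` with `|M| ≥ (Σ_e f e)/(d - 1)`. -/
theorem furedi_partite (V : Type*) [DecidableEq V] (d : ℕ) (hd : 2 ≤ d)
    (E : Finset (Finset V))
    (hrank : ∀ e ∈ E, e.card ≤ d)
    (Vs : Fin d → Set V)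
    (hVdisj : ∀ i j : Fin d, i ≠ j → Disjoint (Vs i) (Vs j))
    (hVcover : (⋃ i, Vs i) = Set.univ)
    (hpartite : ∀ e ∈ E, ∀ i : Fin d, ∃! v : V, v ∈ e ∧ v ∈ Vs i)
    (f : Finset V → ℝ)
    (hf0 : ∀ e ∈ E, 0 ≤ f e)
    (hfm : ∀ v : V, ∑ e ∈ E.filter (fun e => v ∈ e), f e ≤ 1) :
    ∃ M ⊆ E, (∀ e ∈ M, ∀ e' ∈ M, e ≠ e' → Disjoint e e') ∧
      (∑ e ∈ E, f e) / ((d : ℝ) - 1) ≤ (M.card : ℝ) := by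
  classical
  have hcard : ∀ e ∈ E, e.card = d := fun e he => by
    refine le_antisymm (hrank e he) ?_
    choose p hp _ using fun i => hpartite e he i
    have hinj : Function.Injective p := fun i j hij => by
      by_contra hne
      exact Set.disjoint_left.1 (hVdisj i j hne) (hp i).2 (hij ▸ (hp j).2)
    simpa using Finset.card_le_card_of_injOn (s := Finset.univ) p (fun i _ => (hp i).1) hinj.injOn
  let i₀ : Fin d := ⟨0, by omega⟩
  let i₁ : Fin d := ⟨1, by omega⟩
  have hi : i₀ ≠ i₁ := by simp [i₀, i₁]
  let w : V → ℝ := fun v => (if v ∈ Vs i₀ then 1 else 0) - if v ∈ Vs i₁ then 1 else 0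
  have hone : ∀ e ∈ E, ∀ i, ∑ v ∈ e, (if v ∈ Vs i then (1 : ℝ) else 0) = 1 := fun e he i => by
    obtain ⟨v, ⟨hve, hvi⟩, huniq⟩ := hpartite e he i
    rw [Finset.sum_eq_single_of_mem v hve fun u hu huv =>
      if_neg fun hui => huv (huniq u ⟨hu, hui⟩), if_pos hvi]
  obtain ⟨M, hME, hM, hle⟩ := exists_matching_of_balanced d w E hcard
    (fun e he => by simp only [w, Finset.sum_sub_distrib, hone e he, sub_self])
    (fun e he => by
      obtain ⟨v, ⟨hve, hv⟩, -⟩ := hpartite e he i₀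
      have hv' : v ∉ Vs i₁ := Set.disjoint_left.1 (hVdisj i₀ i₁ hi) hv
      exact ⟨v, hve, by simp [w, hv, hv']⟩)
    f hf0 hfm
  have hd' : (0 : ℝ) < (d : ℝ) - 1 := by
    have : (2 : ℝ) ≤ d := by exact_mod_cast hd
    linarith
  exact ⟨M, hME, hM, (div_le_iff₀ hd').2 hle⟩
end
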